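/- arXiv:2504.21219 — 5 statements merged into one kernel-verified Lean document; each statement's English description precedes it below -/
import Mathlib

section
/- Let r ≥ 1 and let γ_1, …, γ_r be pairwise distinct positive real numbers, and set γ_{r+1} = 0. For u ∈ [0,1), with the convention x_0 = 0, the integral over the simplex Δ = {x ∈ ℝ^r : 0 < x_1 < … < x_r < 1} of the function (Σ_{j=1}^r γ_j · 1{x_{j−1} ≤ u < x_j}) · g_γ(x) with respect to Lebesgue measure on ℝ^r equals Σ_{i=1}^r c_i(γ) (1−u)^{γ_i}, where c_i(γ) = Σ_{k=i}^{r} (∏_{j=1}^{k} γ_j) (∏_{j=1, j≠i}^{k} (γ_j−γ_i))^{−1}. (This is the identity E(γ(u)) = Σ_{i=1}^r c_i(γ)(1−u)^{γ_i} of Lemma 1, with the expectation written as an integral against the uniform-baseline GOS density.) -/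
open MeasureTheory Real Finset
open scoped Classical

noncomputable def cc (r : ℕ) (γ : ℕ → ℝ) (i : ℕ) : ℝ :=
  ∑ k ∈ Finset.Icc i r, (∏ j ∈ Finset.Icc 1 k, γ j) *
            (∏ j ∈ (Finset.Icc 1 k).erase i, (γ j - γ i))⁻¹

lemma prod_shift (f : ℕ → ℝ) (k : ℕ) :
    ∏ j ∈ Finset.Icc 1 (k+1), f j = f 1 * ∏ j ∈ Finset.Icc 1 k, f (j+1) := by
  rw [← Finset.mul_prod_Ioc_eq_prod_Icc (by omega)]
  congr 1
  symm
  apply Finset.prod_bij (fun j _ => j+1)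
  · intro a; simp; try omega
  · intro a _ b _; simp
  · intro b hb; simp at hb; exact ⟨b-1, by simp; omega, by omega⟩
  · intros; rfl

lemma sum_shift (f : ℕ → ℝ) (k : ℕ) :
    ∑ j ∈ Finset.Icc 1 (k+1), f j = f 1 + ∑ j ∈ Finset.Icc 1 k, f (j+1) := by
  rw [← Finset.add_sum_Ioc_eq_sum_Icc (by omega)]
  congr 1
  symm
  apply Finset.sum_bij (fun j _ => j+1)
  · intro a; simp; try omega
  · intro a _ b _; simp
  · intro b hb; simp at hb; exact ⟨b-1, by simp; omega, by omega⟩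
  · intros; rfl

lemma cc_succ (r : ℕ) (γ : ℕ → ℝ) (i : ℕ) (hi : 1 ≤ i) :
    cc (r+1) γ (i+1) = γ 1 / (γ 1 - γ (i+1)) * cc r (fun j => γ (j+1)) i := by
  unfold cc
  rw [Finset.mul_sum]
  symm
  apply Finset.sum_bij (fun j _ => j+1)
  · intro a; simp; try omega
  · intro a _ b _; simp
  · intro b hb; simp at hb; exact ⟨b-1, by simp; omega, by omega⟩
  · intro k hk
    simp at hk
    rw [prod_shift]
    have : ∏ j ∈ (Finset.Icc 1 (k+1)).erase (i+1), (γ j - γ (i+1)) =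
        (γ 1 - γ (i+1)) * ∏ j ∈ (Finset.Icc 1 k).erase i, (γ (j+1) - γ (i+1)) := by
      rw [← Finset.mul_prod_erase _ _ (a := 1) (by simp; omega)]
      congr 1
      symm
      apply Finset.prod_bij (fun j _ => j+1)
      · intro a; simp; omega
      · intro a _ b _; simp
      · intro b hb; simp at hb; exact ⟨b-1, by simp; omega, by omega⟩
      · intros; rfl
    rw [this, mul_inv]
    ring

lemma lag (γ : ℕ → ℝ) (s : Finset ℕ) (hs : 1 < #s) (h : Set.InjOn γ s) :
    ∑ i ∈ s, (∏ j ∈ s.erase i, (γ j - γ i))⁻¹ = 0 := by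
  have h1 := Lagrange.coeff_eq_sum h (P := 1) (by rw [Polynomial.degree_one]; exact_mod_cast (by omega))
  rw [Polynomial.coeff_one, if_neg (by omega)] at h1
  have : ∑ i ∈ s, (∏ j ∈ s.erase i, (γ j - γ i))⁻¹ = (-1)^(#s - 1) * ∑ i ∈ s, 
      (Polynomial.eval (γ i) 1) / (∏ j ∈ s.erase i, (γ i - γ j)) := by
    rw [Finset.mul_sum]
    refine Finset.sum_congr rfl fun i hi => ?_
    have : ∏ j ∈ s.erase i, (γ j - γ i) = (-1)^(#s-1) * ∏ j ∈ s.erase i, (γ i - γ j) := by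
      rw [← Finset.card_erase_of_mem hi, ← Finset.prod_const, ← Finset.prod_mul_distrib]
      exact Finset.prod_congr rfl fun _ _ => by ring
    rw [this, mul_inv, ← inv_pow]
    norm_num
  rw [this, ← h1, mul_zero]

lemma cc_sum (r : ℕ) (hr : 1 ≤ r) (γ : ℕ → ℝ) 
    (hdist : ∀ i ∈ Finset.Icc 1 r, ∀ j ∈ Finset.Icc 1 r, i ≠ j → γ i ≠ γ j) :
    ∑ i ∈ Finset.Icc 1 r, cc r γ i = γ 1 := by
  unfold cc
  rw [Finset.sum_comm' (t' := Finset.Icc 1 r) (s' := fun k => Finset.Icc 1 k) 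
    (by intro x y; simp; omega)]
  rw [Finset.sum_eq_single_of_mem 1 (by simp [hr])]
  · simp
  · intro k hk hk1
    rw [← Finset.mul_sum, lag, mul_zero]
    · simp at hk ⊢; omega
    · intro i hi j hj hij
      simp at hi hj hk
      by_contra hne
      exact hdist i (by simp; omega) j (by simp; omega) hne hij

lemma lint_cons (n : ℕ) (f : (Fin (n+1) → ℝ) → ENNReal) (hf : Measurable f) :
    ∫⁻ x, f x = ∫⁻ y : ℝ, ∫⁻ z : Fin n → ℝ, f (Fin.cons y z) := by
  have h := (volume_preserving_piFinSuccAbove (fun _ : Fin (n+1) => ℝ) 0).symm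
  rw [← h.lintegral_comp hf]
  rw [Measure.volume_eq_prod, lintegral_prod _ (by exact (hf.comp h.measurable).aemeasurable)]
  simp [MeasurableEquiv.piFinSuccAbove, Fin.insertNthEquiv]

lemma lint_top (c a : ℝ) (hc : 0 < c) (ha : a < 1) :
    ∫⁻ y in Set.Ioo a 1, ENNReal.ofReal (c * (1-y)^(c-1)) = ENNReal.ofReal ((1-a)^c) := by
  rw [Measure.restrict_congr_set Ioo_ae_eq_Ioc]
  have h1 : IntervalIntegrable (fun y : ℝ => c * (1-y)^(c-1)) volume a 1 := by
    have := (intervalIntegral.intervalIntegrable_rpow' (a := 1 - a) (b := 0) (r := c-1) (by linarith)).comp_sub_left 1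
    simpa using this.const_mul c
  rw [← ofReal_integral_eq_lintegral_ofReal, ← intervalIntegral.integral_of_le ha.le]
  · rw [intervalIntegral.integral_const_mul,
      intervalIntegral.integral_comp_sub_left (fun y => y^(c-1)), integral_rpow (by left; linarith)]
    simp [hc.ne', Real.zero_rpow]
    field_simp
  · exact (intervalIntegrable_iff_integrableOn_Ioc_of_le ha.le).1 h1
  · refine (ae_restrict_iff' measurableSet_Ioc).2 (ae_of_all _ fun y hy => ?_)
    have : 0 ≤ 1 - y := by linarith [hy.2]
    simp only [Pi.zero_apply]
    positivity

noncomputable def DD (r : ℕ) (γ : ℕ → ℝ) (a : ℝ) (x : Fin r → ℝ) : ℝ :=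
  if (∀ i, a < x i ∧ x i < 1) ∧ StrictMono x then
            (∏ j ∈ Finset.Icc 1 r, γ j) *
              ∏ j : Fin r, (1 - x j) ^ (γ (j.1 + 1) - γ (j.1 + 2) - 1)
          else 0

noncomputable def KK (r : ℕ) (γ : ℕ → ℝ) (a u : ℝ) (x : Fin r → ℝ) : ℝ :=
  ∑ j : Fin r, γ (j.1 + 1) *
          (if (if h : 0 < j.1 then x ⟨j.1 - 1, lt_of_le_of_lt (Nat.sub_le _ _) j.2⟩ else a) ≤ u ∧
              u < x j then (1 : ℝ) else 0)

lemma DD_meas (r : ℕ) (γ : ℕ → ℝ) (a : ℝ) : Measurable (DD r γ a) := by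
  unfold DD
  refine Measurable.ite ?_ ?_ measurable_const
  · rw [Set.ofPred_and]
    refine MeasurableSet.inter ?_ ?_
    · rw [Set.ofPred_forall]
      refine MeasurableSet.iInter fun i => ?_
      exact (measurableSet_lt measurable_const (measurable_pi_apply i)).inter
        (measurableSet_lt (measurable_pi_apply i) measurable_const)
    · unfold StrictMono
      simp only [Set.ofPred_forall]
      refine MeasurableSet.iInter fun i => MeasurableSet.iInter fun j => MeasurableSet.iInter fun h => ?_
      exact measurableSet_lt (measurable_pi_apply i) (measurable_pi_apply j)
  · fun_prop

lemma KK_meas (r : ℕ) (γ : ℕ → ℝ) (a u : ℝ) : Measurable (KK r γ a u) := by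
  unfold KK
  refine Finset.measurable_fun_sum _ fun j _ => Measurable.const_mul ?_ _
  refine Measurable.ite ?_ measurable_const measurable_const
  have hm : Measurable (fun x : Fin r → ℝ => if h : 0 < j.1 then
      x ⟨j.1 - 1, lt_of_le_of_lt (Nat.sub_le _ _) j.2⟩ else a) := by
    split_ifs <;> fun_prop
  have h2 : Measurable (fun x : Fin r → ℝ => x j) := measurable_pi_apply j
  exact (measurableSet_le hm (measurable_const (a := u))).inter
        (measurableSet_lt (measurable_const (a := u)) h2)

lemma KD_meas (r : ℕ) (γ : ℕ → ℝ) (a u : ℝ) : Measurable (fun x => KK r γ a u x * DD r γ a x) :=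
  (KK_meas _ _ _ _).mul (DD_meas _ _ _)

lemma DD_nonneg (r : ℕ) (γ : ℕ → ℝ) (hpos : ∀ j ∈ Finset.Icc 1 r, 0 < γ j) (a : ℝ) (x : Fin r → ℝ) :
    0 ≤ DD r γ a x := by
  unfold DD
  split_ifs with h
  · refine mul_nonneg (Finset.prod_nonneg fun j hj => (hpos j hj).le)
      (Finset.prod_nonneg fun j _ => Real.rpow_nonneg (by linarith [(h.1 j).2]) _)
  · exact le_rfl

lemma KK_nonneg (r : ℕ) (γ : ℕ → ℝ) (hpos : ∀ j ∈ Finset.Icc 1 r, 0 < γ j) (a u : ℝ) (x : Fin r → ℝ) :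
    0 ≤ KK r γ a u x := by
  unfold KK
  refine Finset.sum_nonneg fun j _ => mul_nonneg (hpos _ (by simp)).le ?_
  split_ifs <;> norm_num

noncomputable def ph (γ : ℕ → ℝ) (a y : ℝ) : ℝ :=
  if a < y ∧ y < 1 then γ 1 * (1-y)^(γ 1 - γ 2 - 1) else 0

lemma DD_cons (r : ℕ) (γ : ℕ → ℝ) (a y : ℝ) (z : Fin r → ℝ) :
    DD (r+1) γ a (Fin.cons y z) = ph γ a y * DD r (fun j => γ (j+1)) y z := by
  unfold DD ph
  have hiff : ((∀ i, a < (Fin.cons y z : Fin (r+1) → ℝ) i ∧ (Fin.cons y z : Fin (r+1) → ℝ) i < 1) ∧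
      StrictMono (Fin.cons y z : Fin (r+1) → ℝ)) ↔
      (((a < y ∧ y < 1) ∧ ∀ i, a < z i ∧ z i < 1) ∧ (∀ i, y < z i) ∧ StrictMono z) := by
    rw [Fin.strictMono_cons, Fin.forall_fin_succ]
    simp only [Fin.cons_zero, Fin.cons_succ]
  by_cases h1 : a < y ∧ y < 1
  · rw [if_pos h1]
    by_cases h2 : (∀ i, y < z i ∧ z i < 1) ∧ StrictMono z
    · rw [if_pos h2, if_pos (hiff.2 ⟨⟨h1, fun i => ⟨h1.1.trans (h2.1 i).1, (h2.1 i).2⟩⟩,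
        fun i => (h2.1 i).1, h2.2⟩), prod_shift, Fin.prod_univ_succ]
      simp
      ring
    · rw [if_neg h2, if_neg, mul_zero]
      rw [hiff]
      rintro ⟨⟨_, h3⟩, h4, h5⟩
      exact h2 ⟨fun i => ⟨h4 i, (h3 i).2⟩, h5⟩
  · rw [if_neg h1, if_neg (fun h => h1 (hiff.1 h).1.1), zero_mul]

lemma KK_cons (r : ℕ) (γ : ℕ → ℝ) (a u y : ℝ) (z : Fin r → ℝ) :
    KK (r+1) γ a u (Fin.cons y z) = γ 1 * (if a ≤ u ∧ u < y then 1 else 0) 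
      + KK r (fun j => γ (j+1)) y u z := by
  unfold KK
  rw [Fin.sum_univ_succ]
  congr 1
  refine Finset.sum_congr rfl fun j _ => ?_
  simp only [Fin.val_succ, Fin.cons_succ]
  congr 1
  have : (if h : 0 < j.1 + 1 then (Fin.cons y z : Fin (r+1) → ℝ) ⟨j.1 + 1 - 1, by omega⟩ else a) =
    (if h : 0 < j.1 then z ⟨j.1 - 1, lt_of_le_of_lt (Nat.sub_le _ _) j.2⟩ else y) := by
    rw [dif_pos (by omega)]
    obtain ⟨j, hj⟩ := j
    cases j with
    | zero => simp
    | succ j => 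
      simp
      exact Fin.cons_succ (α := fun _ => ℝ) y z ⟨j, by omega⟩
  rw [← this]

lemma KD_zero (r : ℕ) (γ : ℕ → ℝ) (u y : ℝ) (h : u < y) (z : Fin r → ℝ) :
    KK r γ y u z * DD r γ y z = 0 := by
  unfold DD
  split_ifs with h1
  · have : KK r γ y u z = 0 := by
      unfold KK
      refine Finset.sum_eq_zero fun j _ => ?_
      rw [if_neg, mul_zero]
      rintro ⟨h2, _⟩
      split_ifs at h2
      · linarith [(h1.1 ⟨j.1 - 1, lt_of_le_of_lt (Nat.sub_le _ _) j.2⟩).1]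
      · linarith
    rw [this, zero_mul]
  · simp

lemma ph_nonneg (γ : ℕ → ℝ) (h : 0 < γ 1) (a y : ℝ) : 0 ≤ ph γ a y := by
  unfold ph
  split_ifs with h1
  · exact mul_nonneg h.le (Real.rpow_nonneg (by linarith) _)
  · exact le_rfl

lemma SS (r : ℕ) : ∀ (γ : ℕ → ℝ), (∀ j ∈ Finset.Icc 1 r, 0 < γ j) → γ (r+1) = 0 → 
    ∀ a < 1, ∫⁻ x, ENNReal.ofReal (DD r γ a x) = ENNReal.ofReal ((1-a)^(γ 1)) := by
  induction r with
  | zero =>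
    intro γ _ h0 a ha
    simp [DD, Subsingleton.strictMono, show γ 1 = 0 from h0]
    rw [volume_pi, Measure.pi_of_empty (x := Fin.elim0)]
    simp
  | succ r ih =>
    intro γ hpos h0 a ha
    have h1 : 0 < γ 1 := hpos 1 (by simp)
    have ih' := ih (fun j => γ (j+1)) (fun j hj => hpos _ (by simp at hj ⊢; omega)) h0
    rw [lint_cons _ _ (DD_meas _ _ _).ennreal_ofReal, ← lint_top (γ 1) a h1 ha, 
      ← lintegral_indicator measurableSet_Ioo]
    refine lintegral_congr fun y => ?_
    simp only [DD_cons, ENNReal.ofReal_mul (ph_nonneg γ h1 a y)]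
    rw [lintegral_const_mul _ (DD_meas _ _ _).ennreal_ofReal]
    by_cases hy : a < y ∧ y < 1
    · rw [ih' y hy.2, Set.indicator_of_mem (by exact hy), ← ENNReal.ofReal_mul (ph_nonneg γ h1 a y), ph,
        if_pos hy, mul_assoc, ← Real.rpow_add (by linarith)]
      congr 3
      ring
    · rw [Set.indicator_of_notMem (by exact hy), ph, if_neg hy]
      simp

noncomputable def FF (r : ℕ) (γ : ℕ → ℝ) (a u : ℝ) : ℝ :=
  ∑ i ∈ Finset.Icc 1 r, cc r γ i * (1-u)^(γ i) * (1-a)^(γ 1 - γ i)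

lemma FF_int (r : ℕ) (γ : ℕ → ℝ)
    (hdist : ∀ i ∈ Finset.Icc 1 (r+1), ∀ j ∈ Finset.Icc 1 (r+1), i ≠ j → γ i ≠ γ j)
    (a u : ℝ) (hau : a ≤ u) (hu : u < 1) : 
    IntervalIntegrable (fun y => γ 1 * (1-y)^(γ 1 - γ 2 - 1) * FF r (fun j => γ (j+1)) y u) volume a u ∧ 
    ∫ y in a..u, γ 1 * (1-y)^(γ 1 - γ 2 - 1) * FF r (fun j => γ (j+1)) y u = 
      FF (r+1) γ a u - γ 1 * (1-u)^(γ 1) := by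
  have hint : IntervalIntegrable (fun y => γ 1 * (1-y)^(γ 1 - γ 2 - 1) * FF r (fun j => γ (j+1)) y u) volume a u := by
    apply ContinuousOn.intervalIntegrable
    rw [Set.uIcc_of_le hau]
    have hc : ∀ e : ℝ, ContinuousOn (fun y : ℝ => (1-y)^e) (Set.Icc a u) := fun e =>
      ContinuousOn.rpow_const (by fun_prop) (fun y hy => Or.inl (by linarith [hy.2]))
    unfold FF
    refine ((hc _).const_mul _).mul (continuousOn_finsetSum _ fun i _ => (hc _).const_mul _)
  refine ⟨hint, ?_⟩
  rw [intervalIntegral.integral_eq_sub_of_hasDerivAt (f := fun y => - FF (r+1) γ y u) _ hint]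
  · have : FF (r+1) γ u u = γ 1 * (1-u)^(γ 1) := by
      have hs := cc_sum (r+1) (by omega) γ hdist
      calc FF (r+1) γ u u = ∑ i ∈ Finset.Icc 1 (r+1), cc (r+1) γ i * (1-u)^(γ 1) := ?_
        _ = _ := by rw [← Finset.sum_mul, hs]
      refine Finset.sum_congr rfl fun i _ => ?_
      rw [mul_assoc, ← Real.rpow_add (by linarith)]
      congr 2
      ring
    rw [this]; ring
  · intro y hy
    rw [Set.uIcc_of_le hau] at hy
    have hy1 : 0 < 1 - y := by linarith [hy.2]
    have hd : ∀ e : ℝ, HasDerivAt (fun y : ℝ => (1-y)^e) (-(e * (1-y)^(e-1))) y := fun e => by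
      have := ((hasDerivAt_id' y).const_sub 1).rpow_const (p := e) (Or.inl hy1.ne')
      convert this using 1
      ring
    have := (HasDerivAt.fun_sum (u := Finset.Icc 1 (r+1)) fun i _ => 
      (hd (γ 1 - γ i)).const_mul (cc (r+1) γ i * (1-u)^(γ i))).neg
    convert this using 1
    case e'_8 => rfl
    rw [sum_shift]
    unfold FF
    rw [Finset.mul_sum, sub_self, zero_mul, neg_zero, mul_zero, zero_add, ← Finset.sum_neg_distrib]
    refine Finset.sum_congr rfl fun i hi => ?_
    simp at hi
    rw [cc_succ _ _ _ hi.1]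
    have hne : γ 1 - γ (i+1) ≠ 0 := sub_ne_zero.2 (hdist 1 (by simp) (i+1) (by simp; omega) (by omega))
    have he : (1-y)^(γ 1 - γ (i+1) - 1) = (1-y)^(γ 1 - γ 2 - 1) * (1-y)^(γ 2 - γ (i+1)) := by
      rw [← Real.rpow_add hy1]
      congr 1
      ring
    rw [he]
    field_simp

lemma MM (u : ℝ) (hu : u < 1) (r : ℕ) : ∀ (γ : ℕ → ℝ), (∀ j ∈ Finset.Icc 1 r, 0 < γ j) → γ (r+1) = 0 → 
    (∀ i ∈ Finset.Icc 1 r, ∀ j ∈ Finset.Icc 1 r, i ≠ j → γ i ≠ γ j) → 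
    ∀ a ≤ u, 0 ≤ FF r γ a u ∧ 
      ∫⁻ x, ENNReal.ofReal (KK r γ a u x * DD r γ a x) = ENNReal.ofReal (FF r γ a u) := by
  induction r with
  | zero =>
    intro γ _ h0 _ a ha
    simp [KK, FF]
  | succ r ih =>
    intro γ hpos h0 hdist a ha
    have h1 : 0 < γ 1 := hpos 1 (by simp)
    have hpos' : ∀ j ∈ Finset.Icc 1 r, 0 < (fun j => γ (j+1)) j :=
      fun j hj => hpos _ (by simp at hj ⊢; omega)
    have ih' := ih (fun j => γ (j+1)) hpos' h0 
      (fun i hi j hj hij => hdist _ (by simp at hi ⊢; omega) _ (by simp at hj ⊢; omega) (by omega))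
    have hS := SS r (fun j => γ (j+1)) hpos' h0
    obtain ⟨hint, hval⟩ := FF_int r γ hdist a u ha hu
    have hnn : ∀ y ∈ Set.Ioc a u, 0 ≤ γ 1 * (1-y)^(γ 1 - γ 2 - 1) * FF r (fun j => γ (j+1)) y u := by
      intro y hy
      exact mul_nonneg (mul_nonneg h1.le (Real.rpow_nonneg (by linarith [hy.2]) _)) (ih' y hy.2).1
    have hI : 0 ≤ ∫ y in a..u, γ 1 * (1-y)^(γ 1 - γ 2 - 1) * FF r (fun j => γ (j+1)) y u := by
      rw [intervalIntegral.integral_of_le ha]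
      exact setIntegral_nonneg measurableSet_Ioc hnn
    have hp : 0 ≤ γ 1 * (1-u)^(γ 1) := mul_nonneg h1.le (Real.rpow_nonneg (by linarith) _)
    have hF : FF (r+1) γ a u = (∫ y in a..u, γ 1 * (1-y)^(γ 1 - γ 2 - 1) * FF r (fun j => γ (j+1)) y u)
        + γ 1 * (1-u)^(γ 1) := by rw [hval]; ring
    refine ⟨by rw [hF]; positivity, ?_⟩
    rw [hF, ENNReal.ofReal_add hI hp, ENNReal.ofReal_mul h1.le, ← lint_top (γ 1) u h1 hu,
      intervalIntegral.integral_of_le ha, ofReal_integral_eq_lintegral_ofReal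
        ((intervalIntegrable_iff_integrableOn_Ioc_of_le ha).1 hint)
        ((ae_restrict_iff' measurableSet_Ioc).2 (ae_of_all _ hnn)),
      ← lintegral_const_mul _ (by fun_prop),
      ← lintegral_indicator measurableSet_Ioc, ← lintegral_indicator measurableSet_Ioo,
      ← lintegral_add_right _ (Measurable.indicator (by fun_prop) measurableSet_Ioo),
      lint_cons _ _ (KD_meas _ _ _ _).ennreal_ofReal]
    refine lintegral_congr fun y => ?_
    have hph := ph_nonneg γ h1 a y
    simp only [DD_cons, KK_cons]
    by_cases hy : a < y ∧ y < 1
    · by_cases hyu : y ≤ u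
      · rw [Set.indicator_of_mem (show y ∈ Set.Ioc a u from ⟨hy.1, hyu⟩),
          Set.indicator_of_notMem (fun h => absurd h.1 (by linarith)), add_zero,
          if_neg (fun h => absurd h.2 (by linarith))]
        simp only [mul_zero, zero_add, mul_left_comm _ (ph γ a y), ENNReal.ofReal_mul hph]
        rw [lintegral_const_mul _ (KD_meas _ _ _ _).ennreal_ofReal,
          (ih' y hyu).2, ← ENNReal.ofReal_mul hph, ph, if_pos hy]
      · push Not at hyu
        rw [Set.indicator_of_mem (show y ∈ Set.Ioo u 1 from ⟨hyu, hy.2⟩),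
          Set.indicator_of_notMem (fun h => absurd h.2 (by linarith)), zero_add,
          if_pos ⟨ha, hyu⟩]
        have : ∀ z : Fin r → ℝ, (γ 1 * 1 + KK r (fun j => γ (j+1)) y u z) * 
            (ph γ a y * DD r (fun j => γ (j+1)) y z) = (γ 1 * ph γ a y) * DD r (fun j => γ (j+1)) y z := by
          intro z
          have := KD_zero r (fun j => γ (j+1)) u y hyu z
          linear_combination ph γ a y * this
        simp only [this, ENNReal.ofReal_mul (mul_nonneg h1.le hph)]
        rw [lintegral_const_mul _ (DD_meas _ _ _).ennreal_ofReal, hS y hy.2,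
          ← ENNReal.ofReal_mul (mul_nonneg h1.le hph), ← ENNReal.ofReal_mul h1.le, ph, if_pos hy,
          mul_assoc, mul_assoc, ← Real.rpow_add (by linarith)]
        congr 4
        ring
    · rw [Set.indicator_of_notMem (fun h => hy ⟨h.1, by linarith [h.2]⟩),
        Set.indicator_of_notMem (fun h => hy ⟨by linarith [h.1], h.2⟩), ph, if_neg hy]
      simp

/-- Lemma 1 (identity E(γ(u)) = Σ_{i=1}^r c_i(γ)(1−u)^{γ_i}), with the expectation written
as an integral against the uniform-baseline GOS density. -/
theorem stmt_0 (r : ℕ) (hr : 1 ≤ r) (γ : ℕ → ℝ)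
    (hpos : ∀ j ∈ Finset.Icc 1 r, 0 < γ j)
    (hdist : ∀ i ∈ Finset.Icc 1 r, ∀ j ∈ Finset.Icc 1 r, i ≠ j → γ i ≠ γ j)
    (hγtop : γ (r + 1) = 0)
    (u : ℝ) (hu0 : 0 ≤ u) (hu1 : u < 1) :
    (∫ x : Fin r → ℝ,
        (∑ j : Fin r, γ (j.1 + 1) *
          (if (if h : 0 < j.1 then x ⟨j.1 - 1, lt_of_le_of_lt (Nat.sub_le _ _) j.2⟩ else 0) ≤ u ∧
              u < x j then (1 : ℝ) else 0)) *
        (if (∀ i, 0 < x i ∧ x i < 1) ∧ StrictMono x then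
            (∏ j ∈ Finset.Icc 1 r, γ j) *
              ∏ j : Fin r, (1 - x j) ^ (γ (j.1 + 1) - γ (j.1 + 2) - 1)
          else 0))
      = ∑ i ∈ Finset.Icc 1 r,
          (∑ k ∈ Finset.Icc i r, (∏ j ∈ Finset.Icc 1 k, γ j) *
            (∏ j ∈ (Finset.Icc 1 k).erase i, (γ j - γ i))⁻¹) * (1 - u) ^ γ i := by
  have h := MM u hu1 r γ hpos hγtop hdist 0 hu0
  change ∫ x : Fin r → ℝ, KK r γ 0 u x * DD r γ 0 x = _
  rw [integral_eq_lintegral_of_nonneg_ae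
    (ae_of_all _ fun x => mul_nonneg (KK_nonneg r γ hpos 0 u x) (DD_nonneg r γ hpos 0 x))
    (KD_meas _ _ _ _).aestronglyMeasurable, h.2, ENNReal.toReal_ofReal h.1]
  simp [FF, cc]
end

section
/- Let γ_1, …, γ_r be pairwise distinct real numbers and let 1 ≤ k ≤ r−1. Then for arbitrary real numbers t_1, …, t_{k+1} (assuming additionally γ_i ≠ 0 for all i so that the divisions are defined): (∏_{i=1}^{k+1} γ_i) Σ_{i=1}^{k+1} (a_i^{(k+1)}/γ_i) t_i − (∏_{i=1}^{k} γ_i) Σ_{i=1}^{k} (a_i^{(k)}/γ_i) t_i = (∏_{i=1}^{k} γ_i) Σ_{i=1}^{k+1} a_i^{(k+1)} t_i. (This is the telescoping identity used in the proof of Lemma 1 to compute P(N(u)=k) as a difference of two marginal cdfs, valid coefficient-wise.) -/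
open Finset

/-- Telescoping identity used in the proof of Lemma 1 to compute P(N(u)=k) as a
difference of two marginal cdfs, valid coefficient-wise. -/
theorem stmt_1 (r : ℕ) (γ t : ℕ → ℝ) (k : ℕ) (hk1 : 1 ≤ k) (hkr : k ≤ r - 1)
    (hdist : ∀ i ∈ Finset.Icc 1 r, ∀ j ∈ Finset.Icc 1 r, i ≠ j → γ i ≠ γ j)
    (hne : ∀ i ∈ Finset.Icc 1 r, γ i ≠ 0) :
    (∏ i ∈ Finset.Icc 1 (k + 1), γ i) *
        (∑ i ∈ Finset.Icc 1 (k + 1),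
          (∏ j ∈ (Finset.Icc 1 (k + 1)).erase i, (γ j - γ i))⁻¹ / γ i * t i) -
      (∏ i ∈ Finset.Icc 1 k, γ i) *
        (∑ i ∈ Finset.Icc 1 k,
          (∏ j ∈ (Finset.Icc 1 k).erase i, (γ j - γ i))⁻¹ / γ i * t i)
    = (∏ i ∈ Finset.Icc 1 k, γ i) *
        ∑ i ∈ Finset.Icc 1 (k + 1),
          (∏ j ∈ (Finset.Icc 1 (k + 1)).erase i, (γ j - γ i))⁻¹ * t i := by
  have hr : k + 1 ≤ r := by omega
  have hins : Finset.Icc 1 (k + 1) = insert (k + 1) (Finset.Icc 1 k) := by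
    ext x
    simp only [Finset.mem_Icc, Finset.mem_insert]
    omega
  have hnot : k + 1 ∉ Finset.Icc 1 k := by simp
  have key : ∑ i ∈ Finset.Icc 1 k,
          (∏ j ∈ (Finset.Icc 1 k).erase i, (γ j - γ i))⁻¹ / γ i * t i
      = ∑ i ∈ Finset.Icc 1 (k + 1),
          (∏ j ∈ (Finset.Icc 1 (k + 1)).erase i, (γ j - γ i))⁻¹ * (γ (k + 1) - γ i)
            / γ i * t i := by
    rw [hins, Finset.sum_insert hnot, sub_self, mul_zero, zero_div, zero_mul, zero_add]
    refine Finset.sum_congr rfl fun i hi => ?_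
    have hi' := Finset.mem_Icc.mp hi
    have hik : k + 1 ≠ i := by omega
    have hd : γ (k + 1) - γ i ≠ 0 := sub_ne_zero.mpr
      (hdist _ (Finset.mem_Icc.mpr ⟨by omega, hr⟩) _ (Finset.mem_Icc.mpr ⟨hi'.1, by omega⟩) hik)
    rw [Finset.erase_insert_of_ne hik,
      Finset.prod_insert (fun h => hnot (Finset.mem_of_mem_erase h)), mul_inv, mul_comm _⁻¹ _⁻¹,
      inv_mul_cancel_right₀ hd]
  have hP : ∏ i ∈ Finset.Icc 1 (k + 1), γ i = γ (k + 1) * ∏ i ∈ Finset.Icc 1 k, γ i := by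
    rw [hins, Finset.prod_insert hnot]
  rw [key, hP, Finset.mul_sum, Finset.mul_sum, Finset.mul_sum, ← Finset.sum_sub_distrib]
  refine Finset.sum_congr rfl fun i hi => ?_
  have hi' := Finset.mem_Icc.mp hi
  have h0 : γ i ≠ 0 := hne i (Finset.mem_Icc.mpr ⟨hi'.1, by omega⟩)
  generalize (∏ j ∈ (Finset.Icc 1 (k + 1)).erase i, (γ j - γ i))⁻¹ = A
  field_simp
  ring
end

section
/- Let r ≥ 1, let γ_1, …, γ_r be pairwise distinct positive reals with the convention γ_{r+1} = 0, and let 1 ≤ k ≤ r and u ∈ [0,1). Then the integral over the simplex Δ = {x ∈ ℝ^r : 0 < x_1 < … < x_r < 1} of 1{x_k ≤ u} · g_γ(x) with respect to Lebesgue measure on ℝ^r equals 1 − (∏_{j=1}^{k} γ_j) Σ_{i=1}^{k} (a_i^{(k)}/γ_i) (1−u)^{γ_i}. (Marginal cdf of the k-th generalized order statistic with standard uniform baseline distribution.) -/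
open MeasureTheory Real Finset
open scoped Classical

noncomputable def gosJ (r : ℕ) (γ : ℕ → ℝ) (k : ℕ) (u t : ℝ) : ENNReal :=
  ∫⁻ x : Fin r → ℝ, if (∀ i, t < x i ∧ x i < 1) ∧ StrictMono x ∧ (∀ i : Fin r, i.1 + 1 = k → x i ≤ u)
    then ∏ j : Fin r, ENNReal.ofReal (γ j.1 * (1 - x j) ^ (γ j.1 - γ (j.1 + 1) - 1)) else 0

noncomputable def gosC (k : ℕ) (γ : ℕ → ℝ) (i : ℕ) : ℝ :=
  ∏ j ∈ range k, if j = i then 1 else γ j / (γ j - γ i)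

noncomputable def gosF (k : ℕ) (γ : ℕ → ℝ) (u t : ℝ) : ℝ :=
  (1 - t) ^ (γ 0) - ∑ i ∈ range k, gosC k γ i * (1 - u) ^ (γ i) * (1 - t) ^ (γ 0 - γ i)

lemma gos_meas (r : ℕ) (γ : ℕ → ℝ) (k : ℕ) (u t : ℝ) :
    Measurable (fun x : Fin r → ℝ => if (∀ i, t < x i ∧ x i < 1) ∧ StrictMono x ∧ (∀ i : Fin r, i.1 + 1 = k → x i ≤ u)
    then ∏ j : Fin r, ENNReal.ofReal (γ j.1 * (1 - x j) ^ (γ j.1 - γ (j.1 + 1) - 1)) else 0) := by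
  refine Measurable.ite ?_ ?_ measurable_const
  · have : {x : Fin r → ℝ | (∀ i, t < x i ∧ x i < 1) ∧ StrictMono x ∧ (∀ i : Fin r, i.1 + 1 = k → x i ≤ u)} =
      (⋂ i, ({x | t < x i} ∩ {x | x i < 1})) ∩ ((⋂ i, ⋂ j, ⋂ (_ : i < j), {x | x i < x j}) ∩
        (⋂ i : Fin r, ⋂ (_ : i.1 + 1 = k), {x | x i ≤ u})) := by
      ext x
      simp only [Set.mem_ofPred_eq, Set.mem_inter_iff, Set.mem_iInter]
      rfl
    rw [this]
    refine MeasurableSet.inter ?_ (MeasurableSet.inter ?_ ?_)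
    · exact MeasurableSet.iInter fun i => (measurableSet_lt measurable_const (measurable_pi_apply i)).inter
        (measurableSet_lt (measurable_pi_apply i) measurable_const)
    · exact MeasurableSet.iInter fun i => MeasurableSet.iInter fun j => MeasurableSet.iInter fun _ =>
        (measurableSet_lt (measurable_pi_apply i) (measurable_pi_apply j))
    · exact MeasurableSet.iInter fun i => MeasurableSet.iInter fun _ =>
        (measurableSet_le (measurable_pi_apply i) measurable_const)
  · fun_prop

lemma gos_cons (r : ℕ) (k : ℕ) (u t a : ℝ) (f : Fin r → ℝ) :
    ((∀ i, t < (Fin.cons a f : Fin (r+1) → ℝ) i ∧ (Fin.cons a f : Fin (r+1) → ℝ) i < 1) ∧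
      StrictMono (Fin.cons a f : Fin (r+1) → ℝ) ∧
      (∀ i : Fin (r+1), i.1 + 1 = k → (Fin.cons a f : Fin (r+1) → ℝ) i ≤ u)) ↔
    (t < a ∧ a < 1 ∧ (k = 1 → a ≤ u)) ∧
      ((∀ i, a < f i ∧ f i < 1) ∧ StrictMono f ∧ (∀ i : Fin r, i.1 + 1 = k - 1 → f i ≤ u)) := by
  constructor
  · rintro ⟨h1, h2, h3⟩
    have h10 := h1 0
    simp only [Fin.cons_zero] at h10
    refine ⟨⟨h10.1, h10.2, fun hk => ?_⟩, ⟨fun i => ⟨?_, ?_⟩, ?_, fun i hi => ?_⟩⟩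
    · simpa using h3 0 (by simp [hk])
    · simpa using h2 (Fin.succ_pos i)
    · simpa using (h1 i.succ).2
    · intro i j hij
      simpa using h2 (Fin.succ_lt_succ_iff.2 hij)
    · simpa using h3 i.succ (by simp; omega)
  · rintro ⟨⟨h1, h2, h3⟩, h4, h5, h6⟩
    refine ⟨fun i => ?_, ?_, fun i hi => ?_⟩
    · refine Fin.cases ?_ (fun i => ?_) i
      · simpa using ⟨h1, h2⟩
      · simpa using ⟨h1.trans (h4 i).1, (h4 i).2⟩
    · intro i j
      refine Fin.cases ?_ (fun i => ?_) i <;> refine Fin.cases ?_ (fun j => ?_) j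
      · simp
      · intro _; simpa using (h4 j).1
      · intro h; simp at h
      · intro h; simpa using h5 (Fin.succ_lt_succ_iff.1 h)
    · revert hi
      refine Fin.cases ?_ (fun i => ?_) i
      · intro hi; simpa using h3 (by simpa using hi.symm)
      · intro hi; simpa using h6 i (by simp at hi; omega)

lemma gos_peel (r : ℕ) (γ : ℕ → ℝ) (k : ℕ) (u t : ℝ) :
    gosJ (r + 1) γ k u t = ∫⁻ a : ℝ, if t < a ∧ a < 1 ∧ (k = 1 → a ≤ u) then
      ENNReal.ofReal (γ 0 * (1 - a) ^ (γ 0 - γ 1 - 1)) * gosJ r (fun j => γ (j + 1)) (k - 1) u a else 0 := by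
  have mp := (volume_preserving_piFinSuccAbove (fun _ : Fin (r+1) => ℝ) 0).symm
  unfold gosJ
  rw [← mp.lintegral_comp (gos_meas _ _ _ _ _), Measure.volume_eq_prod]
  refine (lintegral_prod _ ((gos_meas (r+1) γ k u t).comp mp.measurable).aemeasurable).trans ?_
  simp only [Function.comp_apply]
  refine lintegral_congr fun a => ?_
  have e : ∀ f : Fin r → ℝ, (MeasurableEquiv.piFinSuccAbove (fun _ : Fin (r+1) => ℝ) 0).symm (a, f)
      = (Fin.cons a f : Fin (r+1) → ℝ) := by
    intro f
    simp [MeasurableEquiv.piFinSuccAbove, Fin.insertNthEquiv]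
  simp only [e, gos_cons]
  by_cases h : t < a ∧ a < 1 ∧ (k = 1 → a ≤ u)
  · rw [if_pos h, ← lintegral_const_mul' _ _ ENNReal.ofReal_ne_top]
    refine lintegral_congr fun f => ?_
    by_cases hQ : (∀ i, a < f i ∧ f i < 1) ∧ StrictMono f ∧ (∀ i : Fin r, i.1 + 1 = k - 1 → f i ≤ u)
    · rw [if_pos ⟨h, hQ⟩, if_pos hQ, Fin.prod_univ_succ]
      simp
    · rw [if_neg hQ, if_neg (fun h' => hQ (And.right h')), mul_zero]
  · rw [if_neg h]
    refine Eq.trans (lintegral_congr fun x => if_neg ?_) lintegral_zero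
    exact fun h' => h h'.1

lemma gos_int (t v p : ℝ) (htv : t ≤ v) (hp : (v ≤ 1 ∧ -1 < p) ∨ (v < 1 ∧ p ≠ -1)) :
    IntervalIntegrable (fun a => (1 - a) ^ p) volume t v ∧
    ∫ a in t..v, (1 - a) ^ p = ((1 - t) ^ (p + 1) - (1 - v) ^ (p + 1)) / (p + 1) := by
  have h0 : -1 < p ∨ p ≠ -1 ∧ (0:ℝ) ∉ Set.uIcc (1 - v) (1 - t) := by
    rcases hp with h | h
    · exact Or.inl h.2
    · refine Or.inr ⟨h.2, ?_⟩
      rw [Set.uIcc_of_le (by linarith)]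
      intro h'; have := h'.1; linarith
  constructor
  · have : IntervalIntegrable (fun a : ℝ => a ^ p) volume (1 - t) (1 - v) := by
      rcases h0 with h | h
      · exact intervalIntegral.intervalIntegrable_rpow' h
      · exact intervalIntegral.intervalIntegrable_rpow (Or.inr (by rw [Set.uIcc_comm]; exact h.2))
    simpa using this.comp_sub_left 1
  · rw [intervalIntegral.integral_comp_sub_left (fun a => a ^ p), integral_rpow h0]

lemma gos_lint (t v : ℝ) (htv : t ≤ v) (f : ℝ → ℝ) (hf : IntervalIntegrable f volume t v)
    (h0 : ∀ a, t < a → a < v → 0 ≤ f a) :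
    ∫⁻ a in Set.Ioo t v, ENNReal.ofReal (f a) = ENNReal.ofReal (∫ a in t..v, f a) ∧ 0 ≤ ∫ a in t..v, f a := by
  rw [intervalIntegral.integral_of_le htv, integral_Ioc_eq_integral_Ioo]
  have hi : IntegrableOn f (Set.Ioo t v) := by
    rw [intervalIntegrable_iff_integrableOn_Ioo_of_le htv] at hf; exact hf
  have : 0 ≤ᵐ[volume.restrict (Set.Ioo t v)] f := by
    filter_upwards [ae_restrict_mem measurableSet_Ioo] with a ha using h0 a ha.1 ha.2
  exact ⟨(ofReal_integral_eq_lintegral_ofReal hi this).symm, integral_nonneg_of_ae this⟩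

lemma gos_zero (r : ℕ) (γ : ℕ → ℝ) (hpos : ∀ j < r, 0 < γ j) (h0 : γ r = 0) (u t : ℝ) (ht : t < 1) :
    gosJ r γ 0 u t = ENNReal.ofReal ((1 - t) ^ (γ 0)) := by
  induction r generalizing γ t with
  | zero => simp [gosJ, h0, Subsingleton.strictMono, volume_pi, Measure.pi_of_empty]
  | succ r ih =>
    rw [gos_peel]
    have hp := hpos 0 (by omega)
    have hi := gos_int t 1 (γ 0 - 1) ht.le (Or.inl ⟨le_rfl, by linarith⟩)
    have hl := gos_lint t 1 ht.le (fun a => γ 0 * (1 - a) ^ (γ 0 - 1)) (hi.1.const_mul _)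
      (fun a _ h => mul_nonneg hp.le (rpow_nonneg (by linarith) _))
    rw [intervalIntegral.integral_const_mul, hi.2] at hl
    have e : γ 0 * (((1 - t) ^ (γ 0 - 1 + 1) - (1 - 1) ^ (γ 0 - 1 + 1)) / (γ 0 - 1 + 1)) = (1 - t) ^ γ 0 := by
      simp only [sub_add_cancel, sub_self, zero_rpow hp.ne', sub_zero]
      field_simp
    rw [e] at hl
    rw [← hl.1, ← lintegral_indicator measurableSet_Ioo]
    refine lintegral_congr fun a => ?_
    simp only [Set.indicator, Set.mem_Ioo, zero_ne_one, false_imp_iff, and_true]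
    split_ifs with h
    · rw [ih (fun j => γ (j+1)) (fun j hj => hpos _ (by omega)) h0 a h.2]
      have : 0 < 1 - a := by linarith [h.2]
      rw [← ENNReal.ofReal_mul (mul_nonneg hp.le (rpow_nonneg this.le _)), mul_assoc, ← rpow_add this]
      congr 3
      simp; ring
    · rfl

lemma gos_lag (k : ℕ) (hk : 1 ≤ k) (γ : ℕ → ℝ) (hd : ∀ i < k, ∀ j < k, i ≠ j → γ i ≠ γ j) :
    ∑ i ∈ range k, gosC k γ i = 1 := by
  have := Lagrange.sum_basis (s := range k) (v := γ) (F := ℝ) (by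
    intro i hi j hj h
    by_contra hne
    exact hd i (by simpa using hi) j (by simpa using hj) hne h) ⟨0, by simp; omega⟩
  have h := congrArg (Polynomial.eval 0) this
  rw [Polynomial.eval_finsetSum] at h
  simp only [Polynomial.eval_one] at h
  rw [← h]
  refine Finset.sum_congr rfl fun i hi => ?_
  rw [gosC, Lagrange.basis, Polynomial.eval_prod, ← Finset.mul_prod_erase _ _ hi]
  simp only [if_true, one_mul]
  refine Finset.prod_congr rfl fun j hj => ?_
  have hj := Finset.mem_erase.1 hj
  rw [if_neg hj.1, Lagrange.basisDivisor]
  have : γ i ≠ γ j := hd i (by simpa using hi) j (by simpa using hj.2) hj.1.symm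
  simp
  rw [← neg_sub (γ i) (γ j), div_neg]
  field_simp

lemma gos_C_succ (k : ℕ) (γ : ℕ → ℝ) (s : ℕ) :
    gosC (k+1) γ (s+1) = gosC k (fun j => γ (j+1)) s * (γ 0 / (γ 0 - γ (s+1))) := by
  rw [gosC, Finset.prod_range_succ']
  simp [gosC]

lemma gos_main (k r : ℕ) (γ : ℕ → ℝ) (hkr : k ≤ r) (hpos : ∀ j < r, 0 < γ j) (h0 : γ r = 0)
    (hd : ∀ i < r, ∀ j < r, i ≠ j → γ i ≠ γ j) (u t : ℝ) (hu : u < 1) (htu : t ≤ u) :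
    gosJ r γ k u t = ENNReal.ofReal (gosF k γ u t) ∧ 0 ≤ gosF k γ u t := by
  induction k generalizing r γ t with
  | zero =>
    rw [gos_zero r γ hpos h0 u t (by linarith)]
    simp only [gosF, range_zero, sum_empty, sub_zero, true_and]
    exact rpow_nonneg (by linarith) _
  | succ k ih =>
    obtain ⟨r, rfl⟩ : ∃ s, r = s + 1 := ⟨r - 1, by omega⟩
    have ih' := fun a => ih r (fun j => γ (j+1)) (by omega) (fun j hj => hpos _ (by omega)) h0
      (fun i hi j hj hij => hd _ (by omega) _ (by omega) (by omega)) a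
    have hp := hpos 0 (by omega)
    set f : ℝ → ℝ := fun a => γ 0 * (1 - a) ^ (γ 0 - 1) - ∑ i ∈ range k,
      (γ 0 * gosC k (fun j => γ (j+1)) i * (1 - u) ^ (γ (i+1))) * (1 - a) ^ (γ 0 - γ (i+1) - 1) with hf
    have hff : ∀ a < 1, f a = γ 0 * (1 - a) ^ (γ 0 - γ 1 - 1) * gosF k (fun j => γ (j+1)) u a := by
      intro a ha
      have h1 : 0 < 1 - a := by linarith
      simp only [hf, gosF, mul_sub, Finset.mul_sum]
      congr 1
      · rw [mul_assoc, ← rpow_add h1]; congr 2; simp; ring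
      · refine Finset.sum_congr rfl fun i _ => ?_
        rw [show γ 0 - γ (i+1) - 1 = (γ 0 - γ 1 - 1) + (γ (0+1) - γ (i+1)) by simp; ring, rpow_add h1]
        ring
    have hne : ∀ i ∈ range k, γ 0 - γ (i+1) ≠ 0 := fun i hi => by
      have := mem_range.1 hi
      exact sub_ne_zero.2 (hd 0 (by omega) (i+1) (by omega) (by omega))
    have hi0 := gos_int t u (γ 0 - 1) htu (Or.inl ⟨hu.le, by linarith⟩)
    have hi1 : ∀ i ∈ range k, _ := fun i hi => gos_int t u (γ 0 - γ (i+1) - 1) htu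
      (Or.inr ⟨hu, fun h => hne i hi (by linarith)⟩)
    have hI0 : IntervalIntegrable (fun a => γ 0 * (1 - a) ^ (γ 0 - 1)) volume t u := hi0.1.const_mul _
    have hI1 : ∀ i ∈ range k, IntervalIntegrable (fun a => (γ 0 * gosC k (fun j => γ (j+1)) i * (1 - u) ^ (γ (i+1))) * (1 - a) ^ (γ 0 - γ (i+1) - 1)) volume t u :=
      fun i hi => (hi1 i hi).1.const_mul _
    have hIs : IntervalIntegrable (fun a => ∑ i ∈ range k,
      (γ 0 * gosC k (fun j => γ (j+1)) i * (1 - u) ^ (γ (i+1))) * (1 - a) ^ (γ 0 - γ (i+1) - 1)) volume t u := by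
      have := IntervalIntegrable.sum (range k) hI1
      have e : (∑ i ∈ range k, fun a => (γ 0 * gosC k (fun j => γ (j+1)) i * (1 - u) ^ (γ (i+1))) * (1 - a) ^ (γ 0 - γ (i+1) - 1)) = (fun a => ∑ i ∈ range k,
        (γ 0 * gosC k (fun j => γ (j+1)) i * (1 - u) ^ (γ (i+1))) * (1 - a) ^ (γ 0 - γ (i+1) - 1)) := by
        ext a; simp
      rwa [e] at this
    have hIf : IntervalIntegrable f volume t u := hI0.sub hIs
    have hval : ∫ a in t..u, f a = gosF (k+1) γ u t := by
      rw [hf, intervalIntegral.integral_sub hI0 hIs, intervalIntegral.integral_finsetSum hI1,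
        intervalIntegral.integral_const_mul, hi0.2]
      have hu' : 0 < 1 - u := by linarith
      have e1 : ∀ i ∈ range k, ∫ a in t..u, (γ 0 * gosC k (fun j => γ (j+1)) i * (1 - u) ^ (γ (i+1))) * (1 - a) ^ (γ 0 - γ (i+1) - 1)
          = gosC (k+1) γ (i+1) * (1 - u) ^ (γ (i+1)) * (1 - t) ^ (γ 0 - γ (i+1)) - gosC (k+1) γ (i+1) * (1 - u) ^ (γ 0) := by
        intro i hi
        rw [intervalIntegral.integral_const_mul, (hi1 i hi).2, gos_C_succ, sub_add_cancel]
        have := hne i hi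
        have e2 : (1 - u) ^ γ 0 = (1 - u) ^ (γ (i+1)) * (1 - u) ^ (γ 0 - γ (i+1)) := by
          rw [← rpow_add hu']; congr 1; ring
        rw [e2]
        field_simp
      rw [Finset.sum_congr rfl e1, Finset.sum_sub_distrib, ← Finset.sum_mul]
      have hlag := gos_lag (k+1) (by omega) γ (fun i hi j hj => hd i (by omega) j (by omega))
      rw [Finset.sum_range_succ'] at hlag
      rw [gosF, Finset.sum_range_succ', sub_self, rpow_zero, mul_one]
      have : ∑ i ∈ range k, gosC (k + 1) γ (i + 1) = 1 - gosC (k+1) γ 0 := by linarith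
      rw [this, sub_add_cancel]
      field_simp
      ring
    have hl := gos_lint t u htu f hIf (fun a _ h => by
      rw [hff a (by linarith)]
      exact mul_nonneg (mul_nonneg hp.le (rpow_nonneg (by linarith) _)) (ih' a h.le).2)
    rw [hval] at hl
    refine ⟨?_, hl.2⟩
    rw [← hl.1, gos_peel, setLIntegral_congr Ioo_ae_eq_Ioc, ← lintegral_indicator measurableSet_Ioc]
    refine lintegral_congr fun a => ?_
    simp only [Set.indicator, Set.mem_Ioc, add_tsub_cancel_right]
    by_cases hau : a ≤ u
    · have ha1 : a < 1 := by linarith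
      simp only [hau, ha1, implies_true, and_true]
      split_ifs with h
      · rw [(ih' a hau).1, hff a ha1, ENNReal.ofReal_mul (mul_nonneg hp.le (rpow_nonneg (by linarith) _))]
      · rfl
    · simp only [hau, and_false, if_false]
      split_ifs with h
      · have hk : k ≠ 0 := fun hk => h.2.2 (by omega)
        have : gosJ r (fun j => γ (j+1)) k u a = 0 := by
          unfold gosJ
          refine Eq.trans (lintegral_congr fun x => if_neg ?_) lintegral_zero
          rintro ⟨h1, -, h3⟩
          have h4 := h3 ⟨k - 1, by omega⟩ (by simp; omega)
          have h5 := (h1 ⟨k - 1, by omega⟩).1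
          linarith
        rw [this, mul_zero]
      · rfl

lemma gos_prod_Icc (k : ℕ) (f : ℕ → ℝ) : ∏ j ∈ Finset.Icc 1 k, f j = ∏ j ∈ range k, f (j+1) := by
  rw [Finset.range_eq_Ico, Finset.prod_Ico_add' f 0 k 1]; rfl

theorem stmt_2 (r : ℕ) (hr : 1 ≤ r) (γ : ℕ → ℝ)
    (hpos : ∀ j ∈ Finset.Icc 1 r, 0 < γ j)
    (hdist : ∀ i ∈ Finset.Icc 1 r, ∀ j ∈ Finset.Icc 1 r, i ≠ j → γ i ≠ γ j)
    (hγtop : γ (r + 1) = 0)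
    (k : ℕ) (hk1 : 1 ≤ k) (hkr : k ≤ r)
    (u : ℝ) (hu0 : 0 ≤ u) (hu1 : u < 1) :
    (∫ x : Fin r → ℝ,
        (if x ⟨k - 1, by omega⟩ ≤ u then (1 : ℝ) else 0) *
        (if (∀ i, 0 < x i ∧ x i < 1) ∧ StrictMono x then
            (∏ j ∈ Finset.Icc 1 r, γ j) *
              ∏ j : Fin r, (1 - x j) ^ (γ (j.1 + 1) - γ (j.1 + 2) - 1)
          else 0))
      = 1 - (∏ j ∈ Finset.Icc 1 k, γ j) *
          ∑ i ∈ Finset.Icc 1 k,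
            (∏ j ∈ (Finset.Icc 1 k).erase i, (γ j - γ i))⁻¹ / γ i * (1 - u) ^ γ i := by
  have hm := gos_main k r (fun j => γ (j+1)) hkr (fun j hj => hpos _ (by simp; omega)) hγtop
    (fun i hi j hj hij => hdist _ (by simp; omega) _ (by simp; omega) (by omega)) u 0 hu1 hu0
  have hF : gosF k (fun j => γ (j+1)) u 0 = 1 - (∏ j ∈ Finset.Icc 1 k, γ j) *
          ∑ i ∈ Finset.Icc 1 k,
            (∏ j ∈ (Finset.Icc 1 k).erase i, (γ j - γ i))⁻¹ / γ i * (1 - u) ^ γ i := by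
    simp only [gosF, sub_zero, one_rpow, mul_one]
    congr 1
    rw [Finset.mul_sum, Finset.range_eq_Ico]
    have := Finset.sum_Ico_add' (fun i => (∏ j ∈ Finset.Icc 1 k, γ j) * ((∏ j ∈ (Finset.Icc 1 k).erase i, (γ j - γ i))⁻¹ / γ i * (1 - u) ^ γ i)) 0 k 1
    refine Eq.trans ?_ this
    refine Finset.sum_congr rfl fun i hi => ?_
    have hi : i < k := by simpa using hi
    have hm1 : i + 1 ∈ Finset.Icc 1 k := by simp; omega
    have hg : 0 < γ (i+1) := hpos _ (by simp; omega)
    have hc : gosC k (fun j => γ (j+1)) i = ∏ j ∈ (Finset.Icc 1 k).erase (i+1), γ j / (γ j - γ (i+1)) := by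
      have h1 := gos_prod_Icc k (fun j => if j = i + 1 then 1 else γ j / (γ j - γ (i+1)))
      rw [← Finset.mul_prod_erase _ _ hm1] at h1
      simp only [if_true, one_mul, add_left_inj] at h1
      rw [gosC, ← h1]
      refine Finset.prod_congr rfl fun j hj => ?_
      rw [if_neg (Finset.mem_erase.1 hj).1]
    rw [hc, Finset.prod_div_distrib, ← Finset.mul_prod_erase _ _ hm1]
    field_simp
  rw [← hF, ← ENNReal.toReal_ofReal hm.2, ← hm.1, gosJ]
  have hmeas := gos_meas r (fun j => γ (j+1)) k u 0
  rw [← integral_toReal hmeas.aemeasurable]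
  · refine integral_congr_ae (Filter.Eventually.of_forall fun x => ?_)
    have hev : (∀ i : Fin r, i.1 + 1 = k → x i ≤ u) ↔ x ⟨k - 1, by omega⟩ ≤ u := by
      constructor
      · intro h; exact h _ (by simp; omega)
      · intro h i hi
        have : i = ⟨k - 1, by omega⟩ := Fin.ext (by simp; omega)
        rw [this]; exact h
    simp only [hev]
    by_cases h1 : (∀ i, 0 < x i ∧ x i < 1) ∧ StrictMono x
    · by_cases h2 : x ⟨k - 1, by omega⟩ ≤ u
      · rw [if_pos h2, if_pos h1, if_pos ⟨h1.1, h1.2, h2⟩, one_mul, ENNReal.toReal_prod, gos_prod_Icc,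
          ← Fin.prod_univ_eq_prod_range (fun j => γ (j+1)), ← Finset.prod_mul_distrib]
        refine Finset.prod_congr rfl fun j _ => ?_
        rw [ENNReal.toReal_ofReal]
        exact mul_nonneg (hpos _ (by simp)).le (rpow_nonneg (by linarith [(h1.1 j).2]) _)
      · have h3 : ¬ ((∀ i, 0 < x i ∧ x i < 1) ∧ StrictMono x ∧ x ⟨k - 1, by omega⟩ ≤ u) := fun h => h2 h.2.2
        rw [if_neg h2, if_neg h3]; simp
    · have h3 : ¬ ((∀ i, 0 < x i ∧ x i < 1) ∧ StrictMono x ∧ x ⟨k - 1, by omega⟩ ≤ u) :=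
        fun h => h1 ⟨h.1, h.2.1⟩
      rw [if_neg h1, if_neg h3]; simp
  · refine Filter.Eventually.of_forall fun x => ?_
    split_ifs
    · exact ENNReal.prod_lt_top (fun j _ => ENNReal.ofReal_lt_top)
    · simp
end

section
/- Let r ≥ 1, let γ_1, …, γ_r be pairwise distinct positive reals with the convention γ_{r+1} = 0, let 0 ≤ k ≤ r−1 and u ∈ [0,1). Then the integral over the simplex Δ = {x ∈ ℝ^r : 0 < x_1 < … < x_r < 1} of 1{x_k ≤ u < x_{k+1}} · g_γ(x) (with the convention x_0 = 0, so for k = 0 the indicator is 1{u < x_1}) with respect to Lebesgue measure on ℝ^r equals (∏_{i=1}^{k} γ_i) Σ_{i=1}^{k+1} a_i^{(k+1)} (1−u)^{γ_i}, where the empty product for k = 0 equals 1. (This is the formula for P(N(u) = k) derived in the proof of Lemma 1.) -/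
open MeasureTheory Real Finset
open scoped Classical

noncomputable def Phi (k : ℕ) (c : ℕ → ℝ) (s u : ℝ) : ℝ :=
  (∏ i ∈ Finset.range k, c i) * ∑ i ∈ Finset.range (k + 1),
    (∏ j ∈ (Finset.range (k + 1)).erase i, (c j - c i))⁻¹ * (1 - u) ^ c i * (1 - s) ^ (c 0 - c i)

lemma prod_erase_ite (k i : ℕ) (f : ℕ → ℝ) :
    ∏ j ∈ (Finset.range k).erase i, f j = ∏ j ∈ Finset.range k, if j = i then 1 else f j := by
  rw [Finset.prod_ite]
  simp only [Finset.prod_const_one, one_mul]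
  congr 1
  ext j
  simp [and_comm]

lemma prod_erase_succ (k i : ℕ) (f : ℕ → ℝ) :
    ∏ j ∈ (Finset.range (k + 1)).erase (i + 1), f j
      = f 0 * ∏ j ∈ (Finset.range k).erase i, f (j + 1) := by
  rw [prod_erase_ite, prod_erase_ite, Finset.prod_range_succ', mul_comm]
  simp

lemma sum_a_zero (k : ℕ) (c : ℕ → ℝ) (hc : Set.InjOn c (Finset.range (k + 2))) :
    ∑ i ∈ Finset.range (k + 2), (∏ j ∈ (Finset.range (k + 2)).erase i, (c j - c i))⁻¹ = 0 := by
  have h := Lagrange.coeff_eq_sum (s := Finset.range (k + 2)) (v := fun i => - c i)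
    (fun i hi j hj h => hc hi hj (neg_injective h)) (P := (1 : Polynomial ℝ))
    (by simp [Polynomial.degree_one]; exact_mod_cast Nat.succ_pos _)
  rw [Polynomial.coeff_one] at h
  simp only [Finset.card_range] at h
  rw [if_neg (by omega)] at h
  rw [h]
  refine Finset.sum_congr rfl fun i hi => ?_
  simp only [Polynomial.eval_one, one_div]
  congr 1
  refine Finset.prod_congr rfl fun j hj => by ring

lemma Phi_self (k : ℕ) (c : ℕ → ℝ) (hc : Set.InjOn c (Finset.range (k + 2))) (u : ℝ) (hu : u < 1) :
    Phi (k + 1) c u u = 0 := by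
  unfold Phi
  have : ∀ i ∈ Finset.range (k + 1 + 1),
      (∏ j ∈ (Finset.range (k + 1 + 1)).erase i, (c j - c i))⁻¹ * (1 - u) ^ c i * (1 - u) ^ (c 0 - c i)
      = (∏ j ∈ (Finset.range (k + 1 + 1)).erase i, (c j - c i))⁻¹ * (1 - u) ^ c 0 := by
    intro i hi
    rw [mul_assoc, ← Real.rpow_add (by linarith)]
    congr 2; ring
  rw [Finset.sum_congr rfl this, ← Finset.sum_mul, sum_a_zero k c hc]
  simp

lemma Phi_deriv (k : ℕ) (c : ℕ → ℝ) (hc : Set.InjOn c (Finset.range (k + 2))) (a u : ℝ) (ha : a < 1) :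
    HasDerivAt (fun s => Phi (k + 1) c s u)
      (-(c 0 * (1 - a) ^ (c 0 - c 1 - 1) * Phi k (fun j => c (j + 1)) a u)) a := by
  have hd : ∀ p : ℝ, HasDerivAt (fun s : ℝ => (1 - s) ^ p) (-(p * (1 - a) ^ (p - 1))) a := by
    intro p
    have h1 : HasDerivAt (fun s : ℝ => 1 - s) (-1) a := by
      simpa using (hasDerivAt_id a).const_sub 1
    have := h1.rpow_const (p := p) (Or.inl (by linarith))
    convert this using 1
    ring
  have h2 := (HasDerivAt.fun_sum (u := Finset.range (k + 1 + 1))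
    (A := fun i s => (∏ j ∈ (Finset.range (k + 1 + 1)).erase i, (c j - c i))⁻¹ * (1 - u) ^ c i
      * (1 - s) ^ (c 0 - c i)) (fun i _ => (hd (c 0 - c i)).const_mul _)).const_mul
        (∏ i ∈ Finset.range (k + 1), c i)
  unfold Phi
  refine h2.congr_deriv (Eq.symm ?_)
  rw [Finset.sum_range_succ' _ (k + 1), Finset.prod_range_succ']
  simp only [sub_self, zero_mul, neg_zero, mul_zero, add_zero]
  rw [Finset.mul_sum, Finset.mul_sum, Finset.mul_sum, ← Finset.sum_neg_distrib]
  refine Finset.sum_congr rfl fun i hi => ?_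
  rw [prod_erase_succ]
  have hne : c 0 - c (i + 1) ≠ 0 := by
    intro h
    have := hc (by simp) (by simpa using hi) (sub_eq_zero.1 h)
    omega
  have e : (1 - a) ^ (c 0 - c (i + 1) - 1)
      = (1 - a) ^ (c 0 - c 1 - 1) * (1 - a) ^ (c (0 + 1) - c (i + 1)) := by
    rw [← Real.rpow_add (by linarith)]
    congr 1; ring_nf
  rw [e, mul_inv]
  field_simp

lemma injOn_shift (k : ℕ) (c : ℕ → ℝ) (hc : Set.InjOn c (Finset.range (k + 1))) :
    Set.InjOn (fun j => c (j + 1)) (Finset.range k) := by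
  intro i hi j hj h
  have := hc (by simpa using hi) (by simpa using hj) h
  omega

lemma Phi_cont (k : ℕ) (c : ℕ → ℝ) (s u : ℝ) (hs : s ≤ u) (hu : u < 1) :
    ContinuousOn (fun a => c 0 * (1 - a) ^ (c 0 - c 1 - 1) * Phi k (fun j => c (j + 1)) a u)
      (Set.uIcc s u) := by
  have hp : ∀ p : ℝ, ContinuousOn (fun a : ℝ => (1 - a) ^ p) (Set.uIcc s u) := by
    intro p
    refine ContinuousOn.rpow_const (by fun_prop) fun x hx => Or.inl ?_
    rw [Set.uIcc_of_le hs] at hx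
    linarith [hx.2]
  unfold Phi
  refine (continuousOn_const.mul (hp _)).mul (continuousOn_const.mul ?_)
  exact continuousOn_finsetSum _ fun i _ => continuousOn_const.mul (hp _)

lemma Phi_int (k : ℕ) (c : ℕ → ℝ) (hc : Set.InjOn c (Finset.range (k + 2))) (s u : ℝ)
    (hs : s ≤ u) (hu : u < 1) :
    ∫ a in s..u, c 0 * (1 - a) ^ (c 0 - c 1 - 1) * Phi k (fun j => c (j + 1)) a u
      = Phi (k + 1) c s u := by
  have h := intervalIntegral.integral_eq_sub_of_hasDerivAt (a := s) (b := u)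
    (f := fun s => - Phi (k + 1) c s u)
    (f' := fun a => c 0 * (1 - a) ^ (c 0 - c 1 - 1) * Phi k (fun j => c (j + 1)) a u)
    (fun x hx => by
      rw [Set.uIcc_of_le hs] at hx
      simpa using (Phi_deriv k c hc x u (by linarith [hx.2])).fun_neg)
    (Phi_cont k c s u hs hu).intervalIntegrable
  rw [h, Phi_self k c hc u hu]
  ring

lemma Phi_nonneg (k : ℕ) : ∀ (c : ℕ → ℝ) (_ : Set.InjOn c (Finset.range (k + 1)))
    (_ : ∀ j < k, 0 < c j) (s u : ℝ)
    (_ : s ≤ u) (_ : u < 1), 0 ≤ Phi k c s u := by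
  induction k with
  | zero =>
    intro c _ _ s u hs hu
    simp [Phi]
    exact Real.rpow_nonneg (by linarith) _
  | succ k ih =>
    intro c hc hp s u hs hu
    rw [← Phi_int k c hc s u hs hu]
    refine intervalIntegral.integral_nonneg hs fun a ha => ?_
    have := ih (fun j => c (j + 1)) (injOn_shift _ c hc) (fun j hj => hp _ (by omega)) a u ha.2 hu
    have h0 := hp 0 (by omega)
    have : 0 ≤ 1 - a := by linarith [ha.2]
    positivity

lemma Phi_lint (k : ℕ) (c : ℕ → ℝ) (hc : Set.InjOn c (Finset.range (k + 2)))
    (hp : ∀ j < k + 1, 0 < c j) (s u : ℝ)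
    (hs : s ≤ u) (hu : u < 1) :
    ∫⁻ a in Set.Ioc s u, ENNReal.ofReal
      (c 0 * (1 - a) ^ (c 0 - c 1 - 1) * Phi k (fun j => c (j + 1)) a u)
      = ENNReal.ofReal (Phi (k + 1) c s u) := by
  rw [← Phi_int k c hc s u hs hu, intervalIntegral.integral_of_le hs,
    ofReal_integral_eq_lintegral_ofReal]
  · exact (intervalIntegrable_iff_integrableOn_Ioc_of_le hs).1
      (Phi_cont k c s u hs hu).intervalIntegrable
  · refine (ae_restrict_iff' measurableSet_Ioc).2 (Filter.Eventually.of_forall fun a ha => ?_)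
    have := Phi_nonneg k (fun j => c (j + 1)) (injOn_shift _ c hc)
      (fun j hj => hp _ (by omega)) a u ha.2 hu
    have h0 := hp 0 (by omega)
    have : 0 ≤ 1 - a := by linarith [ha.2]
    simp only [Pi.zero_apply]
    positivity

lemma pow_lint (p s : ℝ) (hp : 0 < p) (hs : s < 1) :
    ∫⁻ a in Set.Ioc s 1, ENNReal.ofReal (p * (1 - a) ^ (p - 1)) = ENNReal.ofReal ((1 - s) ^ p) := by
  have hi : IntervalIntegrable (fun a : ℝ => p * (1 - a) ^ (p - 1)) volume s 1 := by
    have := (intervalIntegral.intervalIntegrable_rpow' (a := 1 - s) (b := 0)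
      (r := p - 1) (by linarith)).comp_sub_left 1
    simpa using this.const_mul p
  have e : ∫ a in s..1, p * (1 - a) ^ (p - 1) = (1 - s) ^ p := by
    rw [intervalIntegral.integral_const_mul,
      intervalIntegral.integral_comp_sub_left (fun x => x ^ (p - 1)) 1,
      integral_rpow (Or.inl (by linarith))]
    simp [Real.zero_rpow hp.ne']
    field_simp
  rw [← e, intervalIntegral.integral_of_le hs.le, ofReal_integral_eq_lintegral_ofReal]
  · exact (intervalIntegrable_iff_integrableOn_Ioc_of_le hs.le).1 hi
  · refine (ae_restrict_iff' measurableSet_Ioc).2 (Filter.Eventually.of_forall fun a ha => ?_)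
    have : 0 ≤ 1 - a := by linarith [ha.2]
    simp only [Pi.zero_apply]
    positivity

noncomputable def W (n : ℕ) (c : ℕ → ℝ) (s : ℝ) (x : Fin n → ℝ) : ℝ :=
  if (∀ i, s < x i ∧ x i < 1) ∧ StrictMono x then
    ∏ j : Fin n, (c j.1 * (1 - x j) ^ (c j.1 - c (j.1 + 1) - 1)) else 0

def Ind (n k : ℕ) (s u : ℝ) (x : Fin n → ℝ) : Prop :=
  ∃ hk : k < n, (if h : 0 < k then x ⟨k - 1, by omega⟩ else s) ≤ u ∧ u < x ⟨k, hk⟩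

lemma measurable_W (n : ℕ) (c : ℕ → ℝ) (s : ℝ) : Measurable (W n c s) := by
  unfold W
  refine Measurable.ite ?_ (by fun_prop) measurable_const
  have : {x : Fin n → ℝ | (∀ i, s < x i ∧ x i < 1) ∧ StrictMono x}
      = (⋂ i, ({x | s < x i} ∩ {x | x i < 1})) ∩ ⋂ i, ⋂ j, ⋂ (_ : i < j), {x | x i < x j} := by
    ext x
    simp [StrictMono]
  rw [this]
  refine MeasurableSet.inter (MeasurableSet.iInter fun i => ?_)
    (MeasurableSet.iInter fun i => MeasurableSet.iInter fun j => MeasurableSet.iInter fun _ => ?_)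
  · exact (measurableSet_lt measurable_const (measurable_pi_apply i)).inter
      (measurableSet_lt (measurable_pi_apply i) measurable_const)
  · exact measurableSet_lt (measurable_pi_apply i) (measurable_pi_apply j)

lemma measurableSet_Ind (n k : ℕ) (s u : ℝ) : MeasurableSet {x : Fin n → ℝ | Ind n k s u x} := by
  unfold Ind
  by_cases hk : k < n
  · simp only [hk, exists_true_left]
    refine MeasurableSet.inter (s₁ := {x : Fin n → ℝ | (if h : 0 < k then x ⟨k - 1, by omega⟩ else s) ≤ u})
      (s₂ := {x : Fin n → ℝ | u < x ⟨k, hk⟩}) ?_ ?_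
    · by_cases h : 0 < k
      · simp only [h, dite_true]
        exact measurableSet_le (measurable_pi_apply _) measurable_const
      · simp [h]
    · exact measurableSet_lt measurable_const (measurable_pi_apply _)
  · simp [hk]

lemma strictMono_cons_iff {n : ℕ} (a : ℝ) (y : Fin n → ℝ) :
    StrictMono (Fin.cons a y : Fin (n + 1) → ℝ) ↔ (∀ i, a < y i) ∧ StrictMono y := by
  constructor
  · intro h
    refine ⟨fun i => ?_, fun i j hij => ?_⟩
    · simpa using h (Fin.succ_pos i)
    · simpa using h (Fin.succ_lt_succ_iff.2 hij)
  · rintro ⟨h1, h2⟩ i j hij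
    induction i using Fin.cases with
    | zero =>
      induction j using Fin.cases with
      | zero => exact absurd hij (lt_irrefl _)
      | succ j => simpa using h1 j
    | succ i =>
      induction j using Fin.cases with
      | zero => exact absurd hij (by simp)
      | succ j => simpa using h2 (Fin.succ_lt_succ_iff.1 hij)

lemma W_cons (n : ℕ) (c : ℕ → ℝ) (s a : ℝ) (y : Fin n → ℝ) :
    W (n + 1) c s (Fin.cons a y) =
      (if s < a ∧ a < 1 then c 0 * (1 - a) ^ (c 0 - c 1 - 1) else 0)
        * W n (fun j => c (j + 1)) a y := by
  unfold W
  simp only [strictMono_cons_iff, Fin.forall_fin_succ, Fin.prod_univ_succ, Fin.cons_zero,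
    Fin.cons_succ, Fin.val_zero, Fin.val_succ, zero_add]
  by_cases h : s < a ∧ a < 1
  · rw [if_pos h]
    by_cases h' : (∀ i, a < y i ∧ y i < 1) ∧ StrictMono y
    · rw [if_pos h', if_pos]
      exact ⟨⟨h, fun i => ⟨h.1.trans (h'.1 i).1, (h'.1 i).2⟩⟩, fun i => (h'.1 i).1, h'.2⟩
    · rw [if_neg h', if_neg, mul_zero]
      rintro ⟨⟨_, h1⟩, h2, h3⟩
      exact h' ⟨fun i => ⟨h2 i, (h1 i).2⟩, h3⟩
  · rw [if_neg h, if_neg, zero_mul]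
    rintro ⟨⟨h1, _⟩, _⟩
    exact h h1

lemma W_nonneg (n : ℕ) (c : ℕ → ℝ) (hc : ∀ j < n, 0 < c j) (s : ℝ) (x : Fin n → ℝ) :
    0 ≤ W n c s x := by
  unfold W
  split_ifs with h
  · refine Finset.prod_nonneg fun j _ => mul_nonneg (hc _ j.2).le (Real.rpow_nonneg ?_ _)
    linarith [(h.1 j).2]
  · exact le_rfl

lemma lint_split (n : ℕ) (f : (Fin (n + 1) → ℝ) → ENNReal) (hf : Measurable f) :
    ∫⁻ x, f x = ∫⁻ a : ℝ, ∫⁻ y : Fin n → ℝ, f (Fin.cons a y) := by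
  have mp := (volume_preserving_piFinSuccAbove (fun _ : Fin (n + 1) => ℝ) 0).symm
  rw [← mp.lintegral_comp hf, Measure.volume_eq_prod, lintegral_prod]
  · refine lintegral_congr fun a => lintegral_congr fun y => congrArg f ?_
    simp [MeasurableEquiv.piFinSuccAbove, Fin.insertNthEquiv, Fin.insertNth_zero']
  · exact (hf.comp mp.measurable).aemeasurable

lemma lint_W (n : ℕ) : ∀ (c : ℕ → ℝ) (_ : ∀ j < n, 0 < c j) (_ : c n = 0) (s : ℝ) (_ : s < 1),
    ∫⁻ x, ENNReal.ofReal (W n c s x) = ENNReal.ofReal ((1 - s) ^ c 0) := by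
  induction n with
  | zero =>
    intro c _ h0 s hs
    simp [W, h0, Subsingleton.strictMono, volume_pi]
  | succ n ih =>
    intro c hc h0 s hs
    rw [lint_split _ _ (measurable_W _ _ _).ennreal_ofReal, ← pow_lint _ _ (hc 0 (by omega)) hs,
      ← setLIntegral_congr Ioo_ae_eq_Ioc, ← lintegral_indicator measurableSet_Ioo]
    refine lintegral_congr fun a => ?_
    simp only [W_cons]
    by_cases h : s < a ∧ a < 1
    · have hn : 0 ≤ c 0 * (1 - a) ^ (c 0 - c 1 - 1) :=
        mul_nonneg (hc 0 (by omega)).le (Real.rpow_nonneg (by linarith [h.2]) _)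
      rw [Set.indicator_of_mem (show a ∈ Set.Ioo s 1 from h), if_pos h]
      simp only [ENNReal.ofReal_mul hn]
      rw [lintegral_const_mul _ (measurable_W _ _ _).ennreal_ofReal,
        ih (fun j => c (j + 1)) (fun j hj => hc _ (by omega)) h0 a h.2, ← ENNReal.ofReal_mul hn,
        mul_assoc, ← Real.rpow_add (by linarith [h.2])]
      congr 3
      ring_nf
    · rw [Set.indicator_of_notMem (show a ∉ Set.Ioo s 1 from h), if_neg h]
      simp

lemma Ind_cons (n k : ℕ) (s u a : ℝ) (y : Fin n → ℝ) :
    Ind (n + 1) (k + 1) s u (Fin.cons a y) ↔ Ind n k a u y := by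
  unfold Ind
  cases k with
  | zero =>
    constructor
    · rintro ⟨h, h1, h2⟩
      exact ⟨by omega, by simpa using h1, h2⟩
    · rintro ⟨h, h1, h2⟩
      exact ⟨by omega, by simpa using h1, h2⟩
  | succ k =>
    constructor
    · rintro ⟨h, h1, h2⟩
      exact ⟨by omega, h1, h2⟩
    · rintro ⟨h, h1, h2⟩
      exact ⟨by omega, h1, h2⟩

lemma Ind_zero (n : ℕ) (c : ℕ → ℝ) (s u : ℝ) (hs : s ≤ u) (x : Fin (n + 1) → ℝ) :
    (if Ind (n + 1) 0 s u x then (1 : ℝ) else 0) * W (n + 1) c s x = W (n + 1) c u x := by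
  unfold Ind W
  by_cases h : u < x 0
  · rw [if_pos ⟨by omega, by simpa using hs, h⟩, one_mul]
    congr 1
    refine propext (and_congr_left fun hm => ?_)
    refine forall_congr' fun i => and_congr_left fun _ => ?_
    have : u < x i := h.trans_le (hm.monotone (Fin.zero_le i))
    exact ⟨fun _ => this, fun _ => hs.trans_lt this⟩
  · rw [if_neg (fun h' => h h'.2.2), zero_mul, if_neg (fun h' => h (h'.1 0).1)]

lemma Ind_gt (n k : ℕ) (c : ℕ → ℝ) (s u : ℝ) (hs : u < s) (x : Fin n → ℝ) :
    (if Ind n k s u x then (1 : ℝ) else 0) * W n c s x = 0 := by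
  unfold W
  by_cases h : Ind n k s u x
  · rw [if_pos h, if_neg, mul_zero]
    rintro ⟨h1, _⟩
    obtain ⟨hk, h2, _⟩ := h
    split_ifs at h2 with h3
    · linarith [(h1 ⟨k - 1, by omega⟩).1]
    · linarith
  · simp [h]

lemma lint_main (k : ℕ) : ∀ (n : ℕ) (_ : k < n) (c : ℕ → ℝ) (_ : ∀ j < n, 0 < c j) (_ : c n = 0)
    (_ : Set.InjOn c (Finset.range n)) (s u : ℝ) (_ : s ≤ u) (_ : u < 1),
    ∫⁻ x, ENNReal.ofReal ((if Ind n k s u x then (1 : ℝ) else 0) * W n c s x)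
      = ENNReal.ofReal (Phi k c s u) := by
  induction k with
  | zero =>
    intro n hn c hc h0 _ s u hs hu
    obtain ⟨n, rfl⟩ : ∃ m, n = m + 1 := ⟨n - 1, by omega⟩
    simp only [Ind_zero n c s u hs]
    rw [lint_W _ c hc h0 u hu]
    simp [Phi]
  | succ k ih =>
    intro n hn c hc h0 hinj s u hs hu
    obtain ⟨n, rfl⟩ : ∃ m, n = m + 1 := ⟨n - 1, by omega⟩
    have hm : ∀ (n k : ℕ) (c : ℕ → ℝ) (s u : ℝ), Measurable fun x : Fin n → ℝ =>
        ENNReal.ofReal ((if Ind n k s u x then (1 : ℝ) else 0) * W n c s x) := fun n k c s u =>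
      ((Measurable.ite (measurableSet_Ind n k s u) measurable_const measurable_const).mul
        (measurable_W _ _ _)).ennreal_ofReal
    rw [lint_split _ _ (hm _ _ _ _ _), ← Phi_lint k c
      (hinj.mono (by intro i; simp; omega)) (fun j hj => hc j (by omega)) s u hs hu,
      ← lintegral_indicator measurableSet_Ioc]
    refine lintegral_congr fun a => ?_
    simp only [W_cons, Ind_cons]
    by_cases h : s < a ∧ a < 1
    · have hn' : 0 ≤ c 0 * (1 - a) ^ (c 0 - c 1 - 1) :=
        mul_nonneg (hc 0 (by omega)).le (Real.rpow_nonneg (by linarith [h.2]) _)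
      rw [if_pos h]
      simp only [mul_left_comm _ (c 0 * (1 - a) ^ (c 0 - c 1 - 1)), ENNReal.ofReal_mul hn']
      rw [lintegral_const_mul _ (hm _ _ _ _ _)]
      by_cases hau : a ≤ u
      · rw [Set.indicator_of_mem (show a ∈ Set.Ioc s u from ⟨h.1, hau⟩),
          ih n (by omega) (fun j => c (j + 1)) (fun j hj => hc _ (by omega)) h0
            (injOn_shift _ c hinj) a u hau hu, ENNReal.ofReal_mul hn']
      · rw [Set.indicator_of_notMem (fun h' => hau h'.2)]
        simp [Ind_gt n k _ a u (not_le.1 hau)]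
    · rw [Set.indicator_of_notMem (fun h' : a ∈ Set.Ioc s u => h ⟨h'.1, h'.2.trans_lt hu⟩), if_neg h]
      simp

/-- Formula for P(N(u) = k) derived in the proof of Lemma 1. -/
theorem stmt_3 (r : ℕ) (hr : 1 ≤ r) (γ : ℕ → ℝ)
    (hpos : ∀ j ∈ Finset.Icc 1 r, 0 < γ j)
    (hdist : ∀ i ∈ Finset.Icc 1 r, ∀ j ∈ Finset.Icc 1 r, i ≠ j → γ i ≠ γ j)
    (hγtop : γ (r + 1) = 0)
    (k : ℕ) (hkr : k ≤ r - 1)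
    (u : ℝ) (hu0 : 0 ≤ u) (hu1 : u < 1) :
    (∫ x : Fin r → ℝ,
        (if (if h : 0 < k then x ⟨k - 1, by omega⟩ else 0) ≤ u ∧ u < x ⟨k, by omega⟩
          then (1 : ℝ) else 0) *
        (if (∀ i, 0 < x i ∧ x i < 1) ∧ StrictMono x then
            (∏ j ∈ Finset.Icc 1 r, γ j) *
              ∏ j : Fin r, (1 - x j) ^ (γ (j.1 + 1) - γ (j.1 + 2) - 1)
          else 0))
      = (∏ i ∈ Finset.Icc 1 k, γ i) *
          ∑ i ∈ Finset.Icc 1 (k + 1),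
            (∏ j ∈ (Finset.Icc 1 (k + 1)).erase i, (γ j - γ i))⁻¹ * (1 - u) ^ γ i := by
  have hk : k < r := by omega
  set c : ℕ → ℝ := fun j => γ (j + 1) with hcdef
  have hc : ∀ j < r, 0 < c j := fun j hj => hpos _ (by simp; omega)
  have hinj : Set.InjOn c (Finset.range r) := by
    intro i hi j hj h
    by_contra hne
    simp at hi hj
    exact hdist (i + 1) (by simp; omega) (j + 1) (by simp; omega) (by omega) h
  have hIcc : ∀ m, Finset.Icc 1 m = (Finset.range m).map ⟨fun j => j + 1, add_left_injective 1⟩ := by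
    intro m
    ext j
    simp only [Finset.mem_Icc, Finset.mem_map, Finset.mem_range, Function.Embedding.coeFn_mk]
    exact ⟨fun h => ⟨j - 1, by omega, by omega⟩, fun ⟨i, h1, h2⟩ => by omega⟩
  have hI : ∀ x : Fin r → ℝ,
      (if (if h : 0 < k then x ⟨k - 1, by omega⟩ else 0) ≤ u ∧ u < x ⟨k, by omega⟩
          then (1 : ℝ) else 0) *
        (if (∀ i, 0 < x i ∧ x i < 1) ∧ StrictMono x then
            (∏ j ∈ Finset.Icc 1 r, γ j) *
              ∏ j : Fin r, (1 - x j) ^ (γ (j.1 + 1) - γ (j.1 + 2) - 1)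
          else 0) = (if Ind r k 0 u x then (1 : ℝ) else 0) * W r c 0 x := by
    intro x
    unfold Ind W
    simp only [hk, exists_true_left]
    congr 1
    congr 1
    rw [Finset.prod_mul_distrib, hIcc, Finset.prod_map, ← Fin.prod_univ_eq_prod_range]
    rfl
  have hR : (∏ i ∈ Finset.Icc 1 k, γ i) *
          ∑ i ∈ Finset.Icc 1 (k + 1),
            (∏ j ∈ (Finset.Icc 1 (k + 1)).erase i, (γ j - γ i))⁻¹ * (1 - u) ^ γ i
      = Phi k c 0 u := by
    unfold Phi
    rw [hIcc k, hIcc (k + 1), Finset.prod_map, Finset.sum_map]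
    congr 1
    refine Finset.sum_congr rfl fun i hi => ?_
    rw [← Finset.map_erase, Finset.prod_map]
    simp [hcdef]
  rw [hR]
  simp only [hI]
  rw [integral_eq_lintegral_of_nonneg_ae, lint_main k r hk c hc hγtop hinj 0 u hu0 hu1,
    ENNReal.toReal_ofReal]
  · exact Phi_nonneg k c (hinj.mono (by intro i; simp; omega)) (fun j hj => hc j (by omega)) 0 u hu0 hu1
  · refine Filter.Eventually.of_forall fun x => ?_
    have := W_nonneg r c hc 0 x
    simp only [Pi.zero_apply]
    split_ifs <;> simp [this]
  · exact ((Measurable.ite (measurableSet_Ind r k 0 u) measurable_const measurable_const).mul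
        (measurable_W _ _ _)).aestronglyMeasurable
end

section
/- Let r ≥ 1 and let γ_1, …, γ_r be positive reals with the convention γ_{r+1} = 0. Let μ be the measure on ℝ^r having density f^X(x) = (∏_{j=1}^r γ_j) exp(−Σ_{j=1}^r (γ_j−γ_{j+1}) x_j) · 1{0 < x_1 < … < x_r} with respect to Lebesgue measure (the GOS joint density with standard exponential baseline distribution). Then the pushforward of μ under the map x ↦ (γ_1 x_1, γ_2 (x_2−x_1), …, γ_r (x_r−x_{r−1})) equals the r-fold product of the standard exponential distribution (the measure on ℝ with density e^{−t} 1{t > 0}). Equivalently, the normalized spacings γ_j (X^{(j)} − X^{(j−1)}), j = 1, …, r, of exponential-baseline GOS are independent standard exponential random variables (with X^{(0)} = 0). -/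
open MeasureTheory Real Finset
open scoped Classical

lemma aux_lintegral_prod (n : ℕ) (f : Fin n → ℝ → ENNReal) (hf : ∀ i, Measurable (f i)) :
    ∫⁻ x : Fin n → ℝ, ∏ i, f i (x i) = ∏ i, ∫⁻ t, f i t := by
  induction n with
  | zero => simp [volume_pi]
  | succ n ih =>
    have h := (volume_preserving_piFinSuccAbove (fun _ : Fin (n+1) => ℝ) 0).symm
    rw [← h.lintegral_comp_emb (MeasurableEquiv.measurableEmbedding _)]
    simp only [Fin.prod_univ_succ, MeasurableEquiv.piFinSuccAbove_symm_apply,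
      Fin.insertNthEquiv_apply, Fin.insertNth_zero', Fin.cons_zero, Fin.cons_succ]
    rw [Measure.volume_eq_prod, lintegral_prod_mul (f := fun t => f 0 t)
      (g := fun y : Fin n → ℝ => ∏ i, f i.succ (y i)) (hf 0).aemeasurable ?_, ih _ (fun i => hf _)]
    exact (Finset.measurable_prod _ (fun i _ => (hf _).comp (measurable_pi_apply i))).aemeasurable

lemma aux_pi_withDensity (n : ℕ) (g : ℝ → ENNReal) (hg : Measurable g) (hfin : ∀ t, g t ≠ ⊤) :
    (Measure.pi fun _ : Fin n => (volume : Measure ℝ).withDensity g) =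
      (volume : Measure (Fin n → ℝ)).withDensity (fun x => ∏ i, g (x i)) := by
  have : SigmaFinite ((volume : Measure ℝ).withDensity g) :=
    SigmaFinite.withDensity_of_ne_top' hfin
  apply Measure.pi_eq
  intro s hs
  have hS : MeasurableSet (Set.univ.pi s) := MeasurableSet.univ_pi hs
  rw [withDensity_apply _ hS, ← lintegral_indicator hS]
  have : ∀ x : Fin n → ℝ, (Set.univ.pi s).indicator (fun x => ∏ i, g (x i)) x
      = ∏ i, (s i).indicator g (x i) := by
    intro x
    by_cases hx : x ∈ Set.univ.pi s
    · rw [Set.indicator_of_mem hx]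
      exact Finset.prod_congr rfl fun i _ => (Set.indicator_of_mem (hx i (Set.mem_univ _)) _).symm
    · rw [Set.indicator_of_notMem hx]
      simp only [Set.mem_univ_pi, not_forall] at hx
      obtain ⟨i, hi⟩ := hx
      exact (Finset.prod_eq_zero (Finset.mem_univ i) (Set.indicator_of_notMem hi _)).symm
  simp_rw [this]
  rw [aux_lintegral_prod n _ (fun i => hg.indicator (hs i))]
  refine Finset.prod_congr rfl fun i _ => ?_
  rw [withDensity_apply _ (hs i), lintegral_indicator (hs i)]

lemma aux_map_withDensity {α : Type*} [MeasurableSpace α] (μ : Measure α) (T : α → α)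
    (hT : Measurable T) (g : α → ENNReal) (hg : Measurable g) :
    Measure.map T (μ.withDensity (fun x => g (T x))) = (Measure.map T μ).withDensity g := by
  ext s hs
  rw [Measure.map_apply hT hs, withDensity_apply _ (hT hs), withDensity_apply _ hs,
    setLIntegral_map hs hg hT]

/-- extension of a finite vector to all naturals, shifted by one -/
def auxX (r : ℕ) (x : Fin r → ℝ) : ℕ → ℝ
  | 0 => 0
  | (k+1) => if h : k < r then x ⟨k, h⟩ else 0

lemma auxX_succ (r : ℕ) (x : Fin r → ℝ) (j : Fin r) : auxX r x (j.1 + 1) = x j := by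
  simp [auxX]

lemma auxX_self (r : ℕ) (x : Fin r → ℝ) (j : Fin r) : auxX r x j.1 =
    if h : 0 < j.1 then x ⟨j.1 - 1, lt_of_le_of_lt (Nat.sub_le _ _) j.2⟩ else 0 := by
  obtain ⟨k, hk⟩ := j
  cases k with
  | zero => simp [auxX]
  | succ k => simp [auxX, Nat.lt_of_succ_lt hk]

lemma aux_abel (γ X : ℕ → ℝ) (h0 : X 0 = 0) (m : ℕ) :
    ∑ k ∈ range m, γ (k+1) * (X (k+1) - X k) =
      ∑ k ∈ range m, (γ (k+1) - γ (k+2)) * X (k+1) + γ (m+1) * X m := by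
  induction m with
  | zero => simp [h0]
  | succ m ih => rw [sum_range_succ, sum_range_succ, ih]; ring

/-- the spacing map, as a linear map -/
noncomputable def auxT (r : ℕ) (γ : ℕ → ℝ) : (Fin r → ℝ) →ₗ[ℝ] (Fin r → ℝ) where
  toFun := fun (x : Fin r → ℝ) (j : Fin r) =>
          γ (j.1 + 1) *
            (x j - if h : 0 < j.1 then x ⟨j.1 - 1, lt_of_le_of_lt (Nat.sub_le _ _) j.2⟩ else 0)
  map_add' x y := by
    ext j
    by_cases h : 0 < j.1 <;> simp [h] <;> ring
  map_smul' c x := by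
    ext j
    by_cases h : 0 < j.1 <;> simp [h] <;> ring

lemma auxT_apply (r : ℕ) (γ : ℕ → ℝ) (x : Fin r → ℝ) (j : Fin r) :
    auxT r γ x j = γ (j.1 + 1) * (auxX r x (j.1+1) - auxX r x j.1) := by
  rw [auxX_succ, auxX_self]; rfl

lemma aux_prod (γ : ℕ → ℝ) (n : ℕ) :
    ∏ k ∈ range n, γ (k+1) = ∏ j ∈ Finset.Icc 1 n, γ j := by
  induction n with
  | zero => simp
  | succ n ih => rw [Finset.prod_range_succ, Finset.prod_Icc_succ_top (by omega), ih]

lemma auxT_det (r : ℕ) (γ : ℕ → ℝ) : LinearMap.det (auxT r γ) = ∏ j ∈ Finset.Icc 1 r, γ j := by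
  rw [← LinearMap.det_toMatrix', Matrix.det_of_isLowerTriangular]
  · have h1 : ∀ i : Fin r, LinearMap.toMatrix' (auxT r γ) i i = γ (i.1 + 1) := by
      intro i
      rw [LinearMap.toMatrix'_apply, auxT_apply, auxX_succ, auxX_self]
      split_ifs with h
      · rw [Pi.single_eq_same, Pi.single_eq_of_ne]
        · ring
        · intro h'
          have := congrArg Fin.val h'
          simp only at this
          omega
      · simp
    simp only [h1]
    rw [Fin.prod_univ_eq_prod_range (fun k => γ (k+1)) r]
    exact aux_prod γ r
  · intro i j hij
    have hij' : i < j := hij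
    have := Fin.lt_def.mp hij'
    rw [LinearMap.toMatrix'_apply, auxT_apply, auxX_succ, auxX_self,
      Pi.single_eq_of_ne hij'.ne]
    split_ifs with h
    · rw [Pi.single_eq_of_ne]
      · ring
      · intro h'
        have := congrArg Fin.val h'
        simp only at this
        omega
    · simp

lemma aux_cond (r : ℕ) (γ : ℕ → ℝ) (hpos : ∀ j ∈ Finset.Icc 1 r, 0 < γ j) (x : Fin r → ℝ) :
    ((∀ i, 0 < x i) ∧ StrictMono x) ↔ ∀ j, 0 < auxT r γ x j := by
  have hp : ∀ j : Fin r, 0 < γ (j.1+1) := fun j => hpos _ (by simp)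
  have : (∀ j, 0 < auxT r γ x j) ↔ ∀ j : Fin r, auxX r x j.1 < auxX r x (j.1+1) := by
    refine forall_congr' fun j => ?_
    rw [auxT_apply, mul_pos_iff_of_pos_left (hp j), sub_pos]
  rw [this]
  constructor
  · rintro ⟨h1, h2⟩ ⟨k, hk⟩
    rw [auxX_succ r x ⟨k, hk⟩, auxX_self r x ⟨k, hk⟩]
    split_ifs with h
    · apply h2
      simp only [Fin.mk_lt_mk]
      simp at h
      omega
    · exact h1 _
  · intro h
    have key : ∀ b a : ℕ, a < b → b ≤ r → auxX r x a < auxX r x b := by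
      intro b
      induction b with
      | zero => intro a h; omega
      | succ b ih =>
        intro a hab hb
        have h1 := h ⟨b, hb⟩
        rcases Nat.lt_succ_iff_lt_or_eq.mp hab with h2 | rfl
        · exact (ih a h2 (by omega)).trans h1
        · exact h1
    refine ⟨fun i => ?_, fun i j hij => ?_⟩
    · have := key (i.1+1) 0 (by omega) (by omega)
      rwa [auxX_succ] at this
    · have := key (j.1+1) (i.1+1) (by have := Fin.lt_def.mp hij; omega) (by omega)
      rwa [auxX_succ, auxX_succ] at this

lemma aux_sum (r : ℕ) (γ : ℕ → ℝ) (hγtop : γ (r + 1) = 0) (x : Fin r → ℝ) :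
    ∑ j : Fin r, (γ (j.1 + 1) - γ (j.1 + 2)) * x j = ∑ j, auxT r γ x j := by
  have h := aux_abel γ (auxX r x) rfl r
  rw [hγtop, zero_mul, add_zero] at h
  simp only [auxT_apply]
  rw [Fin.sum_univ_eq_sum_range (fun k => γ (k+1) * (auxX r x (k+1) - auxX r x k)), h,
    ← Fin.sum_univ_eq_sum_range (fun k => (γ (k+1) - γ (k+2)) * auxX r x (k+1))]
  simp only [auxX_succ]

/-- The normalized spacings γ_j (X⁽ʲ⁾ − X⁽ʲ⁻¹⁾) of exponential-baseline generalized
order statistics are independent standard exponential random variables. -/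
theorem stmt_6 (r : ℕ) (hr : 1 ≤ r) (γ : ℕ → ℝ)
    (hpos : ∀ j ∈ Finset.Icc 1 r, 0 < γ j) (hγtop : γ (r + 1) = 0) :
    Measure.map
        (fun (x : Fin r → ℝ) (j : Fin r) =>
          γ (j.1 + 1) *
            (x j - if h : 0 < j.1 then x ⟨j.1 - 1, lt_of_le_of_lt (Nat.sub_le _ _) j.2⟩ else 0))
        (volume.withDensity fun x : Fin r → ℝ =>
          ENNReal.ofReal
            (if (∀ i, 0 < x i) ∧ StrictMono x then
              (∏ j ∈ Finset.Icc 1 r, γ j) *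
                Real.exp (-∑ j : Fin r, (γ (j.1 + 1) - γ (j.1 + 2)) * x j)
            else 0))
      = Measure.pi fun _ : Fin r =>
          volume.withDensity fun t : ℝ =>
            ENNReal.ofReal (if 0 < t then Real.exp (-t) else 0) := by
  have hc : 0 < ∏ j ∈ Finset.Icc 1 r, γ j := Finset.prod_pos hpos
  have hg : Measurable fun t : ℝ => ENNReal.ofReal (if 0 < t then Real.exp (-t) else 0) :=
    (Measurable.ite measurableSet_Ioi (by fun_prop) measurable_const).ennreal_ofReal
  have hG : Measurable fun y : Fin r → ℝ =>
      ∏ i, ENNReal.ofReal (if 0 < y i then Real.exp (-y i) else 0) :=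
    Finset.measurable_prod _ (fun i _ => hg.comp (measurable_pi_apply i))
  rw [aux_pi_withDensity r _ hg (fun _ => ENNReal.ofReal_ne_top)]
  have hT : Measurable (auxT r γ) := (auxT r γ).continuous_of_finiteDimensional.measurable
  have hdet : LinearMap.det (auxT r γ) ≠ 0 := by rw [auxT_det]; exact hc.ne'
  have hdens : (fun x : Fin r → ℝ =>
          ENNReal.ofReal
            (if (∀ i, 0 < x i) ∧ StrictMono x then
              (∏ j ∈ Finset.Icc 1 r, γ j) *
                Real.exp (-∑ j : Fin r, (γ (j.1 + 1) - γ (j.1 + 2)) * x j)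
            else 0)) = ENNReal.ofReal (∏ j ∈ Finset.Icc 1 r, γ j) • fun x => (fun y : Fin r → ℝ =>
      ∏ i, ENNReal.ofReal (if 0 < y i then Real.exp (-y i) else 0)) (auxT r γ x) := by
    ext x
    simp only [Pi.smul_apply, smul_eq_mul]
    rw [← ENNReal.ofReal_prod_of_nonneg (fun i _ => by split_ifs <;> positivity),
      ← ENNReal.ofReal_mul hc.le, aux_sum r γ hγtop]
    congr 1
    by_cases h : ∀ j, 0 < auxT r γ x j
    · rw [if_pos ((aux_cond r γ hpos x).2 h)]
      simp only [h, if_true]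
      rw [← Real.exp_sum, Finset.sum_neg_distrib]
    · rw [if_neg (fun h' => h ((aux_cond r γ hpos x).1 h'))]
      push Not at h
      obtain ⟨j, hj⟩ := h
      rw [Finset.prod_eq_zero (Finset.mem_univ j) (if_neg hj.not_gt), mul_zero]
  rw [hdens]
  change Measure.map (auxT r γ) _ = _
  rw [withDensity_smul' _ _ ENNReal.ofReal_ne_top, Measure.map_smul, aux_map_withDensity _ _ hT _ hG,
    Real.map_linearMap_volume_pi_eq_smul_volume_pi hdet, auxT_det, withDensity_smul_measure,
    smul_smul, abs_of_pos (inv_pos.2 hc), ← ENNReal.ofReal_mul hc.le, mul_inv_cancel₀ hc.ne',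
    ENNReal.ofReal_one, one_smul]
end
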